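/- arXiv:1912.12725 — 12 statements merged into one kernel-verified Lean document; each statement's English description precedes it below -/
import Mathlib

section
/- Let n ≥ 1 and let P be a symmetric polynomial in 2n variables with complex coefficients. Then there exists a unique symmetric polynomial Q in n variables with complex coefficients such that for all nonzero complex numbers x_1, …, x_n, P(x_1, …, x_n, x_1^{-1}, …, x_n^{-1}) = Q(x_1 + x_1^{-1}, …, x_n + x_n^{-1}). -/
/-- Chebyshev polynomial of the first kind: T 0 = 1, T 1 = u, T (m+2) = 2u·T(m+1) − T m. -/
noncomputable def chebT : ℕ → ℂ → ℂ
  | 0, _ => 1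
  | 1, u => u
  | (m+2), u => 2 * u * chebT (m+1) u - chebT m u

/-- Chebyshev polynomial of the second kind: U 0 = 1, U 1 = 2u, U (m+2) = 2u·U(m+1) − U m. -/
noncomputable def chebU : ℕ → ℂ → ℂ
  | 0, _ => 1
  | 1, u => 2 * u
  | (m+2), u => 2 * u * chebU (m+1) u - chebU m u

/-- Monic integer Chebyshev polynomial: Tmonic 0 u = 1 and Tmonic m u = 2·T m (u/2) for m ≥ 1. -/
noncomputable def tmonic (m : ℕ) (u : ℂ) : ℂ := if m = 0 then 1 else 2 * chebT m (u / 2)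

/-- Value of the elementary symmetric polynomial e_m at the family y. -/
noncomputable def esymmVal {ι : Type*} [Fintype ι] (m : ℕ) (y : ι → ℂ) : ℂ :=
  ∑ s ∈ Finset.powersetCard m (Finset.univ : Finset ι), ∏ i ∈ s, y i

/-- Value of the complete homogeneous symmetric polynomial h_m at the family y:
the sum over all exponent vectors α with |α| = m of ∏ y i ^ α i. -/
noncomputable def hsymmVal {ι : Type*} [Fintype ι] [DecidableEq ι] (m : ℕ) (y : ι → ℂ) : ℂ :=
  ∑ α ∈ (Fintype.piFinset fun _ : ι => Finset.range (m+1)).filter (fun α => ∑ i, α i = m),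
    ∏ i, y i ^ α i

/-- The symplectic alphabet x₁, …, xₙ, x₁⁻¹, …, xₙ⁻¹, indexed by `Fin n ⊕ Fin n`. -/
noncomputable def sympAlph {n : ℕ} (x : Fin n → ℂ) : Fin n ⊕ Fin n → ℂ :=
  Sum.elim x fun j => (x j)⁻¹

open Polynomial in
/-- the generating polynomial with parameters y -/
noncomputable def genPoly {n : ℕ} {R : Type*} [CommRing R] (y : Fin n → R) : R[X] :=
  ∏ i, (X ^ 2 + C (y i) * X + 1)

open Polynomial in
lemma genPoly_map {n : ℕ} {R S : Type*} [CommRing R] [CommRing S] (f : R →+* S)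
    (y : Fin n → R) : (genPoly y).map f = genPoly (fun i => f (y i)) := by
  simp [genPoly, Polynomial.map_prod]

lemma genPoly_perm {n : ℕ} {R : Type*} [CommRing R] (y : Fin n → R) (e : Equiv.Perm (Fin n)) :
    genPoly (fun i => y (e i)) = genPoly y := by
  unfold genPoly
  exact Equiv.prod_comp e (fun i => (Polynomial.X ^ 2 +
    Polynomial.C (y i) * Polynomial.X + 1))

lemma coeff_genPoly_symm {n : ℕ} (k : ℕ) :
    ((genPoly (fun i : Fin n => (MvPolynomial.X i : MvPolynomial (Fin n) ℂ))).coeff k).IsSymmetric := by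
  intro e
  have h := genPoly_map (MvPolynomial.rename (R := ℂ) e).toRingHom
    (fun i : Fin n => (MvPolynomial.X i : MvPolynomial (Fin n) ℂ))
  have h3 : (fun i : Fin n => (MvPolynomial.rename (R := ℂ) e).toRingHom
      (MvPolynomial.X i : MvPolynomial (Fin n) ℂ)) = fun i => MvPolynomial.X (e i) := by
    funext i
    exact MvPolynomial.rename_X _ _
  rw [h3, genPoly_perm (fun i : Fin n => (MvPolynomial.X i : MvPolynomial (Fin n) ℂ)) e] at h
  have h2 := congrArg (fun p => Polynomial.coeff p k) h
  simp only [Polynomial.coeff_map] at h2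
  generalize (genPoly (fun i : Fin n => (MvPolynomial.X i : MvPolynomial (Fin n) ℂ))).coeff k = q at *
  exact h2

lemma genPoly_symp {n : ℕ} (x : Fin n → ℂ) (hx : ∀ i, x i ≠ 0) :
    genPoly (fun i => x i + (x i)⁻¹)
      = ∏ i : Fin n ⊕ Fin n, (Polynomial.X + Polynomial.C (sympAlph x i)) := by
  rw [Fintype.prod_sum_type, ← Finset.prod_mul_distrib]
  refine Finset.prod_congr rfl fun i _ => ?_
  have h : Polynomial.C (x i) * Polynomial.C (x i)⁻¹ = 1 := by
    rw [← Polynomial.C_mul, mul_inv_cancel₀ (hx i), Polynomial.C_1]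
  simp only [sympAlph, Sum.elim_inl, Sum.elim_inr, Polynomial.C_add]
  linear_combination -h

lemma eval_esymm_symp {n : ℕ} (x : Fin n → ℂ) (hx : ∀ i, x i ≠ 0) (m : ℕ) (hm : m ≤ 2 * n) :
    MvPolynomial.eval (sympAlph x) (MvPolynomial.esymm (Fin n ⊕ Fin n) ℂ m)
      = MvPolynomial.eval (fun j => x j + (x j)⁻¹)
        ((genPoly (fun i : Fin n => (MvPolynomial.X i : MvPolynomial (Fin n) ℂ))).coeff
          (2 * n - m)) := by
  have hc : (Finset.univ : Finset (Fin n ⊕ Fin n)).card = 2 * n := by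
    simp [two_mul]
  rw [← Polynomial.coeff_map, genPoly_map]
  simp only [MvPolynomial.eval_X]
  rw [genPoly_symp x hx, Finset.prod_X_add_C_coeff _ _ (by omega), hc,
    show 2 * n - (2 * n - m) = m by omega]
  simp [MvPolynomial.esymm]

lemma exists_add_inv (y : ℂ) : ∃ x : ℂ, x ≠ 0 ∧ x + x⁻¹ = y := by
  obtain ⟨s, hs⟩ := IsAlgClosed.exists_pow_nat_eq (y ^ 2 - 4) (n := 2) (by norm_num)
  have h : (y + s) / 2 * ((y - s) / 2) = 1 := by linear_combination -hs / 4
  refine ⟨(y + s) / 2, left_ne_zero_of_mul_eq_one h, ?_⟩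
  rw [inv_eq_of_mul_eq_one_right h]
  ring

/-- For every symmetric polynomial `P` in 2n variables there is a unique symmetric
polynomial `Q` in n variables with
`P(x₁,…,xₙ,x₁⁻¹,…,xₙ⁻¹) = Q(x₁+x₁⁻¹,…,xₙ+xₙ⁻¹)` for all nonzero `x₁,…,xₙ`. -/
theorem exists_unique_symm_of_symplectic (n : ℕ) (hn : 1 ≤ n)
    (P : MvPolynomial (Fin n ⊕ Fin n) ℂ) (hP : P.IsSymmetric) :
    ∃! Q : MvPolynomial (Fin n) ℂ, Q.IsSymmetric ∧
      ∀ x : Fin n → ℂ, (∀ i, x i ≠ 0) →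
        MvPolynomial.eval (sympAlph x) P
          = MvPolynomial.eval (fun j => x j + (x j)⁻¹) Q := by
  obtain ⟨R, hR⟩ := MvPolynomial.esymmAlgHom_surjective (R := ℂ) (σ := Fin n ⊕ Fin n)
    (n := 2 * n) (by simp [two_mul]) ⟨P, hP⟩
  have hR' := congrArg Subtype.val hR
  rw [MvPolynomial.esymmAlgHom_apply] at hR'
  let c : Fin (2 * n) → MvPolynomial.symmetricSubalgebra (Fin n) ℂ := fun i =>
    ⟨(genPoly (fun i : Fin n => (MvPolynomial.X i : MvPolynomial (Fin n) ℂ))).coeff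
          (2 * n - (i + 1)), coeff_genPoly_symm _⟩
  have key : ∀ x : Fin n → ℂ, (∀ i, x i ≠ 0) →
        MvPolynomial.eval (sympAlph x) P
          = MvPolynomial.eval (fun j => x j + (x j)⁻¹) (MvPolynomial.aeval c R).1 := by
    intro x hx
    have e : (((MvPolynomial.aeval (sympAlph x)).comp
        (MvPolynomial.aeval (fun i : Fin (2 * n) =>
          MvPolynomial.esymm (Fin n ⊕ Fin n) ℂ (i + 1))) : MvPolynomial (Fin (2 * n)) ℂ →ₐ[ℂ] ℂ))
        = ((MvPolynomial.aeval (fun j => x j + (x j)⁻¹)).comp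
          (MvPolynomial.symmetricSubalgebra (Fin n) ℂ).val).comp (MvPolynomial.aeval c) := by
      apply MvPolynomial.algHom_ext
      intro i
      simp only [AlgHom.comp_apply, MvPolynomial.aeval_X]
      have := eval_esymm_symp x hx (i + 1) (by omega)
      rw [← MvPolynomial.coe_aeval_eq_eval, ← MvPolynomial.coe_aeval_eq_eval] at this
      exact this
    have e2 := DFunLike.congr_fun e R
    simp only [AlgHom.comp_apply] at e2
    rw [hR'] at e2
    rw [← MvPolynomial.coe_aeval_eq_eval, ← MvPolynomial.coe_aeval_eq_eval]
    exact e2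
  refine ⟨(MvPolynomial.aeval c R).1, ⟨(MvPolynomial.aeval c R).2, key⟩, ?_⟩
  rintro Q ⟨-, hQ⟩
  apply MvPolynomial.funext
  intro y
  choose x hx0 hx using fun i => exists_add_inv (y i)
  have := (hQ x hx0).symm.trans (key x hx0)
  simpa only [hx] using this
end

section
/- Let n ≥ 1, let λ_1 ≥ λ_2 ≥ … ≥ λ_ℓ > 0 be integers with ℓ ≤ n, and set λ_j := 0 for ℓ < j ≤ n. Let x_1, …, x_n be nonzero complex numbers and z_j := x_j + x_j^{-1}. Define H_r := h_r(x_1, …, x_n, x_1^{-1}, …, x_n^{-1}) for r ≥ 0 and H_r := 0 for r < 0. Then det[ H_{λ_j − j + k} − H_{λ_j − j − k} ]_{j,k=1}^{ℓ} · ∏_{1 ≤ j < k ≤ n} (z_j − z_k) = det[ T^monic_{λ_j + n − j}(z_k) ]_{j,k=1}^{n}. -/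
namespace OrthJT

open PowerSeries in
/-- Coefficients of a power series, extended by zero to negative indices. -/
noncomputable def ext (f : PowerSeries ℂ) (r : ℤ) : ℂ := if r < 0 then 0 else coeff r.toNat f

open PowerSeries in
lemma ext_quad (f : PowerSeries ℂ) (u v : ℂ) (r : ℤ) :
    ext ((1 - C u * X + C v * X ^ 2) * f) r = ext f r - u * ext f (r - 1) + v * ext f (r - 2) := by
  have e : (1 - C u * X + C v * X ^ 2) * f = f - C u * (X * f) + C v * (X * (X * f)) := by ring
  rw [e]
  unfold ext
  by_cases h : r < 0
  · rw [if_pos h, if_pos h, if_pos (by omega), if_pos (by omega)]; simp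
  · rw [if_neg h, if_neg h]
    obtain ⟨m, rfl⟩ : ∃ m : ℕ, r = m := ⟨r.toNat, by omega⟩
    rcases m with _ | _ | m
    · simp
    · simp [coeff_succ_X_mul]
    · rw [if_neg (by omega), if_neg (by omega)]
      have h1 : ((((m + 1 + 1 : ℕ) : ℤ)) - 1).toNat = m + 1 := by omega
      have h2 : ((((m + 1 + 1 : ℕ) : ℤ)) - 2).toNat = m := by omega
      have h0 : ((((m + 1 + 1 : ℕ) : ℤ))).toNat = m + 1 + 1 := by omega
      rw [h1, h2, h0]
      simp [coeff_succ_X_mul]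

/-- Symmetric difference operator. -/
def D (H : ℤ → ℂ) (k b : ℤ) : ℂ := H (b + k + 1) - H (b - k - 1)

lemma D_rec (H : ℤ → ℂ) (k b : ℤ) :
    D H k (b + 1) + D H k (b - 1) = D H (k + 1) b + D H (k - 1) b := by
  unfold D
  have h1 : b + 1 + k + 1 = b + (k + 1) + 1 := by ring
  have h2 : b + 1 - k - 1 = b - (k - 1) - 1 := by ring
  have h3 : b - 1 + k + 1 = b + (k - 1) + 1 := by ring
  have h4 : b - 1 - k - 1 = b - (k + 1) - 1 := by ring
  rw [h1, h2, h3, h4]; ring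

lemma D_neg_one (H : ℤ → ℂ) (b : ℤ) : D H (-1) b = 0 := by
  unfold D; ring_nf

/-- One step of the expansion. -/
lemma step (H : ℤ → ℂ) (Φ : ℤ → ℂ) (N : ℕ) (z : ℂ) (c : ℕ → ℂ) (hc : ∀ k, N ≤ k → c k = 0)
    (h : ∀ b, Φ b = ∑ k ∈ Finset.range N, c k * D H k b) :
    ∃ c' : ℕ → ℂ, (∀ k, N + 1 ≤ k → c' k = 0) ∧
      ∀ b, Φ (b + 1) - z * Φ b + Φ (b - 1) = ∑ k ∈ Finset.range (N + 1), c' k * D H k b := by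
  refine ⟨fun k => (if k = 0 then 0 else c (k - 1)) + c (k + 1) - z * c k, ?_, ?_⟩
  · intro k hk
    simp only
    rw [if_neg (by omega), hc _ (by omega), hc _ (by omega), hc _ (by omega)]; simp
  · intro b
    have e1 : ∑ k ∈ Finset.range (N + 1), (if k = 0 then 0 else c (k - 1)) * D H k b
        = ∑ k ∈ Finset.range N, c k * D H (k + 1) b := by
      rw [Finset.sum_range_succ']; simp
    have e2 : ∑ k ∈ Finset.range (N + 1), c (k + 1) * D H k b
        = ∑ k ∈ Finset.range N, c k * D H (k - 1) b := by
      have a1 := Finset.sum_range_succ' (fun k : ℕ => c k * D H ((k : ℤ) - 1) b) (N + 1)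
      have a2 := Finset.sum_range_succ (fun k : ℕ => c k * D H ((k : ℤ) - 1) b) (N + 1)
      have a3 := Finset.sum_range_succ (fun k : ℕ => c k * D H ((k : ℤ) - 1) b) N
      rw [hc N le_rfl] at a3
      rw [hc (N + 1) (by omega), a3] at a2
      rw [a2] at a1
      simp [D_neg_one] at a1
      exact a1.symm
    have e3 : ∑ k ∈ Finset.range (N + 1), z * c k * D H k b
        = z * ∑ k ∈ Finset.range N, c k * D H k b := by
      rw [Finset.sum_range_succ, hc N le_rfl, Finset.mul_sum]; simp [mul_assoc]
    simp only [sub_mul, add_mul, Finset.sum_add_distrib, Finset.sum_sub_distrib]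
    rw [e1, e2, e3, h, h, h]
    have e4 : ∀ k : ℕ, c k * D H (k + 1) b + c k * D H (k - 1) b
        = c k * D H k (b + 1) + c k * D H k (b - 1) := by
      intro k; rw [← mul_add, ← mul_add, D_rec]
    rw [← Finset.sum_add_distrib, Finset.sum_congr rfl (fun k _ => e4 k), Finset.sum_add_distrib]
    ring

open PowerSeries in
/-- The quadratic factor. -/
noncomputable def quad (z : ℂ) : PowerSeries ℂ := 1 - C z * X + C 1 * X ^ 2

lemma expand {ι : Type*} [DecidableEq ι] (z : ι → ℂ) (f : PowerSeries ℂ) (s : Finset ι) :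
    ∃ c : ℕ → ℂ, (∀ k, s.card + 1 ≤ k → c k = 0) ∧
      ∀ b : ℤ, ext ((∏ i ∈ s, quad (z i)) * f) (b + s.card + 1)
          - ext ((∏ i ∈ s, quad (z i)) * f) (b + s.card - 1)
        = ∑ k ∈ Finset.range (s.card + 1), c k * D (ext f) k b := by
  induction s using Finset.induction_on with
  | empty =>
    refine ⟨fun k => if k = 0 then 1 else 0, ?_, ?_⟩
    · intro k hk; simp at hk; simp; omega
    · intro b; simp [D]
  | insert i s hi ih =>
    obtain ⟨c, hc, h⟩ := ih
    obtain ⟨c', hc', h'⟩ := step (ext f) _ _ (z i) c hc h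
    rw [Finset.card_insert_of_notMem hi]
    refine ⟨c', hc', fun b => ?_⟩
    rw [← h' b, Finset.prod_insert hi, mul_assoc]
    conv_lhs => rw [quad]
    rw [ext_quad, ext_quad]
    push_cast
    ring_nf

open PowerSeries in
lemma geom_mul (y : ℂ) : (1 - C y * X) * PowerSeries.mk (fun m => y ^ m) = 1 := by
  ext m
  rw [sub_mul, one_mul, mul_assoc]
  cases m with
  | zero => simp
  | succ m => simp [coeff_succ_X_mul, pow_succ', coeff_one]

lemma hsymm_coeff {ι : Type*} [Fintype ι] [DecidableEq ι] (m : ℕ) (y : ι → ℂ) :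
    hsymmVal m y = PowerSeries.coeff m (∏ i, PowerSeries.mk (fun k => y i ^ k)) := by
  rw [PowerSeries.coeff_prod]
  unfold hsymmVal
  symm
  refine Finset.sum_bij (fun (l : ι →₀ ℕ) _ => (l : ι → ℕ)) ?_ ?_ ?_ ?_
  · intro l hl
    simp only [Finset.mem_finsuppAntidiag] at hl
    simp only [Finset.mem_filter, Fintype.mem_piFinset, Finset.mem_range]
    refine ⟨fun i => ?_, hl.1⟩
    have := Finset.single_le_sum (f := l) (fun _ _ => Nat.zero_le _) (Finset.mem_univ i)
    exact Nat.lt_succ_of_le (this.trans (le_of_eq hl.1))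
  · intro a _ b _ h; exact DFunLike.coe_injective h
  · intro b hb
    simp only [Finset.mem_filter] at hb
    exact ⟨Finsupp.equivFunOnFinite.symm b, by simp [hb.2], by simp⟩
  · intro l _; simp

/-- Recurrence of the monic Chebyshev polynomials. -/
lemma tmonic_rec (m : ℕ) (z : ℂ) :
    tmonic (m + 2) z = z * tmonic (m + 1) z - (if m = 0 then 2 else 1) * tmonic m z := by
  unfold tmonic
  rcases m with _ | m
  · simp [chebT]; ring
  · simp [chebT]; ring

lemma tmonic_poly (m : ℕ) : ∃ q : Polynomial ℂ, q.Monic ∧ q.natDegree = m ∧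
    ∀ z, q.eval z = tmonic m z := by
  induction m using Nat.strong_induction_on with
  | _ m ih =>
    rcases m with _ | _ | m
    · exact ⟨1, Polynomial.monic_one, by simp, by simp [tmonic]⟩
    · exact ⟨Polynomial.X, Polynomial.monic_X, by simp, fun z => by simp [tmonic, chebT]; ring⟩
    · obtain ⟨p, hp, hpd, hpe⟩ := ih (m + 1) (by omega)
      obtain ⟨q, hq, hqd, hqe⟩ := ih m (by omega)
      have hX : (Polynomial.X * p).Monic := Polynomial.monic_X.mul hp
      have hXd : (Polynomial.X * p).natDegree = m + 2 := by
        rw [Polynomial.monic_X.natDegree_mul hp, hpd]; simp; omega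
      have hlt : (Polynomial.C (if m = 0 then 2 else 1 : ℂ) * q).degree
          < (Polynomial.X * p).degree := by
        apply Polynomial.degree_lt_degree
        rw [hXd]
        have := Polynomial.natDegree_C_mul_le (if m = 0 then 2 else 1 : ℂ) q
        omega
      refine ⟨Polynomial.X * p - Polynomial.C (if m = 0 then 2 else 1 : ℂ) * q,
        hX.sub_of_left hlt, ?_, ?_⟩
      · rw [Polynomial.natDegree_eq_of_degree_eq (Polynomial.degree_sub_eq_left_of_degree_lt hlt),
          hXd]
      · intro z
        rw [tmonic_rec, ← hpe, ← hqe]; simp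

open PowerSeries in
lemma tmonic_gen (z : ℂ) :
    quad z * PowerSeries.mk (fun m => tmonic m z) = 1 - C 0 * X + C (-1) * X ^ 2 := by
  have e : quad z * PowerSeries.mk (fun m => tmonic m z)
    = PowerSeries.mk (fun m => tmonic m z) - C z * (X * PowerSeries.mk (fun m => tmonic m z))
      + X * (X * PowerSeries.mk (fun m => tmonic m z)) := by
    simp only [quad, map_one]; ring
  rw [e]
  ext m
  rcases m with _ | _ | m
  · simp [tmonic]
  · simp [coeff_succ_X_mul, tmonic, chebT, coeff_one, coeff_X_pow]; ring
  · simp only [map_add, map_sub, coeff_succ_X_mul, coeff_mk, coeff_C_mul, tmonic_rec, coeff_one,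
      coeff_X_pow]
    rcases m with _ | m
    · simp [tmonic]; ring
    · simp

lemma tmonic_of_inv (z : ℂ) (g : PowerSeries ℂ) (hg : g * quad z = 1) (m : ℕ) (r : ℤ)
    (hr : r = m) : ext g r - ext g (r - 2) = tmonic m z := by
  have h := ext_quad g 0 (-1) r
  rw [← tmonic_gen z] at h
  have e : quad z * PowerSeries.mk (fun m => tmonic m z) * g
      = PowerSeries.mk (fun m => tmonic m z) := by
    rw [mul_comm, ← mul_assoc, hg, one_mul]
  rw [e] at h
  subst hr
  have h2 : ext (PowerSeries.mk (fun m => tmonic m z)) (m : ℤ) = tmonic m z := by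
    simp [ext]
  rw [h2] at h
  rw [h]; ring

lemma det_tmonic (n : ℕ) (z : Fin n → ℂ) :
    Matrix.det (Matrix.of fun j k : Fin n => tmonic (n - 1 - (j : ℕ)) (z k))
      = ∏ j : Fin n, ∏ k ∈ Finset.Ioi j, (z j - z k) := by
  choose q hq hqd hqe using tmonic_poly
  have h1 := Matrix.det_eval_matrixOfPolynomials_eq_det_vandermonde z (fun i : Fin n => q i)
    (fun i => hqd i) (fun i => hq i)
  have h2 : (Matrix.projVandermonde (1 : Fin n → ℂ) z).det
      = ((Matrix.vandermonde z).submatrix id Fin.revPerm).det := by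
    congr 1; ext i j
    simp [Matrix.projVandermonde_apply, Matrix.vandermonde_apply]
  have h3 := Matrix.det_projVandermonde (1 : Fin n → ℂ) z
  simp only [Pi.one_apply, one_mul] at h3
  rw [← h3, h2, Matrix.det_permute', h1, ← Matrix.det_permute', ← Matrix.det_transpose]
  congr 1
  ext i j
  simp only [Matrix.transpose_apply, Matrix.of_apply, Matrix.submatrix_apply, id, hqe,
    Fin.revPerm_apply, Fin.val_rev]
  congr 1; omega

/-- The big Jacobi-Trudi matrix. -/
noncomputable def bigM (n : ℕ) (H : ℤ → ℂ) (lam : Fin n → ℕ) : Matrix (Fin n) (Fin n) ℂ :=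
  Matrix.of fun j k => H ((lam j : ℤ) - ((j : ℕ) : ℤ) + ((k : ℕ) : ℤ))
          - H ((lam j : ℤ) - ((j : ℕ) : ℤ) - ((k : ℕ) : ℤ) - 2)

lemma bigM_lower (n : ℕ) (H : ℤ → ℂ) (hHneg : ∀ r : ℤ, r < 0 → H r = 0) (lam : Fin n → ℕ)
    (j k : Fin n) (hj : lam j = 0) (hkj : k < j) : bigM n H lam j k = 0 := by
  have : (k : ℕ) < j := hkj
  simp only [bigM, Matrix.of_apply]
  rw [hHneg _ (by omega), hHneg _ (by omega)]; simp

lemma bigM_diag (n : ℕ) (H : ℤ → ℂ) (hHneg : ∀ r : ℤ, r < 0 → H r = 0) (h0 : H 0 = 1)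
    (lam : Fin n → ℕ) (j : Fin n) (hj : lam j = 0) : bigM n H lam j j = 1 := by
  simp only [bigM, Matrix.of_apply]
  rw [hHneg ((lam j : ℤ) - ((j : ℕ) : ℤ) - ((j : ℕ) : ℤ) - 2) (by omega), hj]; simp [h0]

lemma det_bigM (n ℓ : ℕ) (hl : ℓ ≤ n) (H : ℤ → ℂ) (hHneg : ∀ r : ℤ, r < 0 → H r = 0)
    (h0 : H 0 = 1) (lam : Fin n → ℕ) (hzero : ∀ j : Fin n, ℓ ≤ (j : ℕ) → lam j = 0) :
    (bigM n H lam).det = Matrix.det (Matrix.of fun j k : Fin ℓ =>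
        H ((lam ⟨j, lt_of_lt_of_le j.isLt hl⟩ : ℤ) - ((j : ℕ) : ℤ) + ((k : ℕ) : ℤ))
          - H ((lam ⟨j, lt_of_lt_of_le j.isLt hl⟩ : ℤ) - ((j : ℕ) : ℤ) - ((k : ℕ) : ℤ) - 2)) := by
  rw [Matrix.twoBlockTriangular_det (bigM n H lam) (fun j => (j : ℕ) < ℓ)]
  · have hb : (Matrix.toSquareBlockProp (bigM n H lam) fun i => ¬ (i : ℕ) < ℓ).det = 1 := by
      rw [Matrix.det_of_isUpperTriangular]
      · apply Finset.prod_eq_one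
        intro i _
        exact bigM_diag n H hHneg h0 lam i (hzero _ (not_lt.mp i.2))
      · intro i j hij
        exact bigM_lower n H hHneg lam i j (hzero _ (not_lt.mp i.2)) hij
    rw [hb, mul_one]
    let e : Fin ℓ ≃ {j : Fin n // (j : ℕ) < ℓ} :=
      { toFun := fun j => ⟨⟨j, lt_of_lt_of_le j.isLt hl⟩, j.isLt⟩
        invFun := fun j => ⟨j.1, j.2⟩
        left_inv := fun j => rfl
        right_inv := fun j => rfl }
    rw [← Matrix.det_submatrix_equiv_self e]
    rfl
  · intro i hi j hj
    apply bigM_lower n H hHneg lam i j (hzero _ (not_lt.mp hi))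
    rw [Fin.lt_def]; omega

lemma factor (n : ℕ) (x : Fin n → ℂ) (hx : ∀ j, x j ≠ 0)
    (z : Fin n → ℂ) (hz : ∀ j, z j = x j + (x j)⁻¹)
    (H : ℤ → ℂ)
    (hH : ∀ r : ℤ, 0 ≤ r → H r = hsymmVal r.toNat (sympAlph x))
    (hHneg : ∀ r : ℤ, r < 0 → H r = 0) :
    H 0 = 1 ∧ ∃ M : Matrix (Fin n) (Fin n) ℂ, ∀ lam : Fin n → ℕ,
      (Matrix.of fun j k : Fin n => tmonic (lam j + (n - 1 - (j : ℕ))) (z k))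
        = bigM n H lam * M := by
  set F : PowerSeries ℂ := ∏ i, PowerSeries.mk (fun k => sympAlph x i ^ k) with hF
  have hHF : H = ext F := by
    funext r
    by_cases hr : r < 0
    · rw [hHneg r hr, ext, if_pos hr]
    · rw [hH r (by omega), ext, if_neg hr, hsymm_coeff]
  have hprod : (∏ i, quad (z i)) * F = 1 := by
    rw [hF, Fintype.prod_sum_type, ← Finset.prod_mul_distrib, ← Finset.prod_mul_distrib]
    apply Finset.prod_eq_one
    intro i _
    have hq : quad (z i) = (1 - PowerSeries.C (x i) * PowerSeries.X)
        * (1 - PowerSeries.C ((x i)⁻¹) * PowerSeries.X) := by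
      have : PowerSeries.C (x i) * PowerSeries.C ((x i)⁻¹) = 1 := by
        rw [← map_mul, mul_inv_cancel₀ (hx i), map_one]
      rw [quad, hz, map_add, map_one]
      linear_combination (-PowerSeries.X ^ 2) * this
    rw [hq]
    have h1 := geom_mul (x i)
    have h2 := geom_mul ((x i)⁻¹)
    simp only [sympAlph, Sum.elim_inl, Sum.elim_inr]
    calc _ = ((1 - PowerSeries.C (x i) * PowerSeries.X) * PowerSeries.mk (fun m => x i ^ m))
          * ((1 - PowerSeries.C ((x i)⁻¹) * PowerSeries.X)
            * PowerSeries.mk (fun m => (x i)⁻¹ ^ m)) := by ring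
      _ = 1 := by rw [h1, h2, one_mul]
  refine ⟨?_, ?_⟩
  · rw [hH 0 le_rfl, hsymm_coeff]
    simp
  have key : ∀ c : Fin n, ∃ w : ℕ → ℂ, ∀ b : ℤ, ∀ m : ℕ, b + n = m →
      tmonic m (z c) = ∑ k ∈ Finset.range n, w k * D H k b := by
    intro c
    have hcard : (Finset.univ.erase c).card + 1 = n := by
      rw [Finset.card_erase_add_one (Finset.mem_univ c)]; simp
    obtain ⟨w, -, hw⟩ := expand z F (Finset.univ.erase c)
    refine ⟨w, fun b m hm => ?_⟩
    have h := hw b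
    rw [hcard, ← hHF] at h
    rw [← h]
    symm
    have hinv : (∏ i ∈ Finset.univ.erase c, quad (z i)) * F * quad (z c) = 1 := by
      rw [← hprod, ← Finset.mul_prod_erase _ _ (Finset.mem_univ c)]; ring
    rw [← tmonic_of_inv (z c) _ hinv m (b + (Finset.univ.erase c).card + 1) (by omega)]
    congr 2; ring
  choose w hw using key
  refine ⟨Matrix.of fun k c => w c k, fun lam => ?_⟩
  ext j c
  have hj := j.isLt
  rw [Matrix.mul_apply, Matrix.of_apply,
    hw c ((lam j : ℤ) - ((j : ℕ) : ℤ) - 1) _ (by omega), Finset.sum_range]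
  apply Finset.sum_congr rfl
  intro k _
  simp only [bigM, Matrix.of_apply, D]
  rw [mul_comm]
  congr 3 <;> ring

end OrthJT

/-- Orthogonal Jacobi–Trudi identity versus the monic-Chebyshev-T bialternant.
With 1-based indices: `λⱼ − j + k = lam j₀ − j₀ + k₀` and
`λⱼ − j − k = lam j₀ − j₀ − k₀ − 2` for 0-based `j₀ = j−1`, `k₀ = k−1`;
`λⱼ + n − j = lam j₀ + (n − 1 − j₀)`. -/
theorem orthogonal_jacobiTrudi_eq_chebyshevT_bialternant
    (n ℓ : ℕ) (hn : 1 ≤ n) (hl : ℓ ≤ n)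
    (lam : Fin n → ℕ) (hanti : Antitone lam)
    (hpos : ∀ j : Fin n, (j : ℕ) < ℓ → 0 < lam j)
    (hzero : ∀ j : Fin n, ℓ ≤ (j : ℕ) → lam j = 0)
    (x : Fin n → ℂ) (hx : ∀ j, x j ≠ 0)
    (z : Fin n → ℂ) (hz : ∀ j, z j = x j + (x j)⁻¹)
    (H : ℤ → ℂ)
    (hH : ∀ r : ℤ, 0 ≤ r → H r = hsymmVal r.toNat (sympAlph x))
    (hHneg : ∀ r : ℤ, r < 0 → H r = 0) :
    Matrix.det (Matrix.of fun j k : Fin ℓ =>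
        H ((lam ⟨j, lt_of_lt_of_le j.isLt hl⟩ : ℤ) - ((j : ℕ) : ℤ) + ((k : ℕ) : ℤ))
          - H ((lam ⟨j, lt_of_lt_of_le j.isLt hl⟩ : ℤ) - ((j : ℕ) : ℤ) - ((k : ℕ) : ℤ) - 2)) *
      (∏ j : Fin n, ∏ k ∈ Finset.Ioi j, (z j - z k))
    = Matrix.det (Matrix.of fun j k : Fin n =>
        tmonic (lam j + (n - 1 - (j : ℕ))) (z k)) := by
  obtain ⟨h0, M, hM⟩ := OrthJT.factor n x hx z hz H hH hHneg
  have h1 : M.det = ∏ j : Fin n, ∏ k ∈ Finset.Ioi j, (z j - z k) := by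
    have h2 := hM (fun _ => 0)
    simp only [zero_add] at h2
    rw [← OrthJT.det_tmonic, h2, Matrix.det_mul,
      OrthJT.det_bigM n 0 (Nat.zero_le _) H hHneg h0 (fun _ => 0) (fun _ _ => rfl)]
    simp
  rw [hM lam, Matrix.det_mul, h1, OrthJT.det_bigM n ℓ hl H hHneg h0 lam hzero]
end

section
/- Let n ≥ 1, let x_1, …, x_n be nonzero complex numbers, z_j := x_j + x_j^{-1}, and let 0 ≤ m ≤ 2n. Then e_m(x_1, …, x_n, x_1^{-1}, …, x_n^{-1}) = Σ_{k = max(0, m−n)}^{⌊m/2⌋} binom(n − m + 2k, k) · e_{m−2k}(z_1, …, z_n). -/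
open Polynomial in
lemma prod_gen_aux {ι : Type*} [Fintype ι] (y : ι → ℂ) (a : ℂ[X]) :
    ∏ i, (C (y i) * X + a) = ∑ j ∈ Finset.range (Fintype.card ι + 1),
      C (esymmVal j y) * (X ^ j * a ^ (Fintype.card ι - j)) := by
  classical
  rw [Finset.prod_add, Finset.sum_powerset, Finset.card_univ]
  refine Finset.sum_congr rfl fun j _ => ?_
  rw [esymmVal, map_sum, Finset.sum_mul]
  refine Finset.sum_congr rfl fun t ht => ?_
  have hc := (Finset.mem_powersetCard.1 ht).2
  rw [Finset.prod_mul_distrib, Finset.prod_const, Finset.prod_const,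
    Finset.card_sdiff_of_subset (Finset.subset_univ t), Finset.card_univ, hc, map_prod, mul_assoc]

open Polynomial in
lemma coeff_aux (N m j : ℕ) : (X ^ j * (1 + X ^ 2) ^ N : ℂ[X]).coeff m =
    if j ≤ m then (if 2 ∣ m - j then ((N.choose ((m - j) / 2) : ℕ) : ℂ) else 0) else 0 := by
  have h : ((1 + X ^ 2) ^ N : ℂ[X]) = expand ℂ 2 ((1 + X) ^ N) := by simp
  rw [coeff_X_pow_mul', h, coeff_expand (by norm_num), coeff_one_add_X_pow]

/-- `e_m(x,x⁻¹) = Σ_{k=max(0,m−n)}^{⌊m/2⌋} C(n−m+2k, k) e_{m−2k}(z)` where `z_j = x_j + x_j⁻¹`.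
Note `m - n` is ℕ-truncated subtraction, i.e. `max (0) (m−n)`, and since `k ≥ m − n`
the natural number `n + 2*k - m` equals the integer `n − m + 2k`. -/
theorem esymm_symplectic_eq_sum_esymm_z (n m : ℕ) (hn : 1 ≤ n) (hm : m ≤ 2 * n)
    (x : Fin n → ℂ) (hx : ∀ j, x j ≠ 0)
    (z : Fin n → ℂ) (hz : ∀ j, z j = x j + (x j)⁻¹) :
    esymmVal m (sympAlph x)
      = ∑ k ∈ Finset.Icc (m - n) (m / 2),
          (((n + 2 * k - m).choose k : ℕ) : ℂ) * esymmVal (m - 2 * k) z := by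
  have key : ∏ i, (Polynomial.C (sympAlph x i) * Polynomial.X + 1) =
      ∏ j, (Polynomial.C (z j) * Polynomial.X + (1 + Polynomial.X ^ 2)) := by
    rw [Fintype.prod_sum_type, ← Finset.prod_mul_distrib]
    refine Finset.prod_congr rfl fun j _ => ?_
    have h1 : (Polynomial.C (x j) * Polynomial.C (x j)⁻¹ : Polynomial ℂ) = 1 := by
      rw [← Polynomial.C_mul, mul_inv_cancel₀ (hx j), Polynomial.C_1]
    simp only [sympAlph, Sum.elim_inl, Sum.elim_inr, hz, Polynomial.C_add]
    linear_combination Polynomial.X ^ 2 * h1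
  rw [prod_gen_aux, prod_gen_aux] at key
  have key2 := congrArg (fun p => Polynomial.coeff p m) key
  simp only [Polynomial.finset_sum_coeff, Polynomial.coeff_C_mul, coeff_aux, one_pow, mul_one,
    Polynomial.coeff_X_pow, Fintype.card_sum, Fintype.card_fin] at key2
  have hL : m < n + n + 1 := by omega
  simp only [mul_ite, mul_one, mul_zero, Finset.sum_ite_eq, Finset.mem_range, hL, if_true] at key2
  rw [key2]
  symm
  refine Finset.sum_of_injOn (fun k => m - 2 * k) ?_ ?_ ?_ ?_
  · intro a ha b hb hab
    simp only [Finset.coe_Icc, Set.mem_Icc] at ha hb hab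
    omega
  · intro a ha
    simp only [Finset.coe_Icc, Set.mem_Icc, Finset.coe_range, Set.mem_Iio] at ha ⊢
    omega
  · intro j hj hj'
    simp only [Finset.mem_range] at hj
    split_ifs with h1 h2
    · rw [Nat.choose_eq_zero_of_lt, Nat.cast_zero, mul_zero]
      by_contra hlt
      apply hj'
      refine ⟨(m - j) / 2, ?_, ?_⟩
      · simp only [Finset.coe_Icc, Set.mem_Icc]
        omega
      · simp only
        omega
    · rfl
    · rfl
  · intro k hk
    simp only [Finset.mem_Icc] at hk
    have h1 : m - (m - 2 * k) = 2 * k := by omega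
    have h2 : n - (m - 2 * k) = n + 2 * k - m := by omega
    simp only [h1, h2]
    rw [if_pos (by omega), if_pos (by omega), mul_comm, Nat.mul_div_cancel_left k (by norm_num)]
end

section
/- Let n ≥ 1, let x_1, …, x_n be nonzero complex numbers, z_j := x_j + x_j^{-1}, and let 0 ≤ m ≤ n. Then e_m(z_1, …, z_n) = Σ_{k=0}^{⌊m/2⌋} (−1)^k · τ_{n−m+2k, k} · e_{m−2k}(x_1, …, x_n, x_1^{-1}, …, x_n^{-1}), where τ_{s,k} := (s−k−1)!·s / (k!·(s−2k)!) for integers s ≥ 1 and 0 ≤ k ≤ ⌊s/2⌋, and τ_{0,0} := 1. -/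
/-- The coefficient τ_{s,k} = (s−k−1)!·s / (k!·(s−2k)!) for s ≥ 1, with τ_{0,0} = 1. -/
noncomputable def tauCoef (s k : ℕ) : ℂ :=
  if s = 0 then 1
  else ((s - k - 1).factorial : ℂ) * (s : ℂ) / ((k.factorial : ℂ) * ((s - 2 * k).factorial : ℂ))

open Polynomial in
theorem esymmVal_eq_coeff {ι : Type*} [Fintype ι] (y : ι → ℂ) (k : ℕ) (hk : k ≤ Fintype.card ι) :
    esymmVal (Fintype.card ι - k) y = (∏ i, (X + C (y i))).coeff k := by
  rw [Finset.prod_X_add_C_coeff Finset.univ y (by simpa using hk)]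
  rfl

/-- Coefficients of the symplectic product, centered. -/
noncomputable def symA : List ℂ → ℤ → ℂ
  | [], i => if i = 0 then 1 else 0
  | z :: l, i => symA l (i + 1) + z * symA l i + symA l (i - 1)

/-- Coefficients of the product of the `X + z`. -/
noncomputable def symB : List ℂ → ℕ → ℂ
  | [], d => if d = 0 then 1 else 0
  | z :: l, 0 => z * symB l 0
  | z :: l, (d + 1) => symB l d + z * symB l (d + 1)

theorem symA_neg (l : List ℂ) : ∀ i, symA l (-i) = symA l i := by
  induction l with
  | nil => intro i; simp [symA]
  | cons z l ih =>
    intro i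
    have h1 := ih (i - 1)
    have h2 := ih (i + 1)
    rw [show -(i - 1) = -i + 1 by ring] at h1
    rw [show -(i + 1) = -i - 1 by ring] at h2
    simp only [symA, h1, h2, ih i]
    ring

theorem symA_zero (l : List ℂ) : ∀ i : ℤ, (l.length : ℤ) < i → symA l i = 0 := by
  induction l with
  | nil => intro i hi; simp at hi; simp [symA]; omega
  | cons z l ih =>
    intro i hi
    simp only [List.length_cons] at hi
    push_cast at hi
    simp only [symA]
    rw [ih _ (by omega), ih _ (by omega), ih _ (by omega)]
    ring

theorem symA_zero' (l : List ℂ) (i : ℤ) (h : i < -(l.length : ℤ)) : symA l i = 0 := by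
  rw [← symA_neg]; exact symA_zero l _ (by omega)

open Polynomial in
theorem symB_coeff (l : List ℂ) : ∀ d, (l.map (fun z => X + C z)).prod.coeff d = symB l d := by
  induction l with
  | nil => intro d; simp [symB, coeff_one]
  | cons z l ih =>
    intro d
    rw [List.map_cons, List.prod_cons, add_mul]
    cases d with
    | zero => simp [symB, ← ih]
    | succ d => simp [symB, ← ih, coeff_X_mul]

open Polynomial in
theorem symA_coeff (l : List ℂ) : ∀ r : ℕ,
    (l.map (fun z => X ^ 2 + C z * X + 1)).prod.coeff r = symA l ((r : ℤ) - l.length) := by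
  induction l with
  | nil => intro r; simp [symA, coeff_one]
  | cons z l ih =>
    intro r
    rw [List.map_cons, List.prod_cons]
    generalize (l.map (fun z => X ^ 2 + C z * X + 1)).prod = P at ih ⊢
    rw [add_mul, add_mul, one_mul, mul_assoc, pow_two, mul_assoc]
    simp only [symA, List.length_cons]
    match r with
    | 0 =>
      have h1 : symA l (((0 : ℕ) : ℤ) - ((l.length + 1 : ℕ) : ℤ)) = 0 :=
        symA_zero' _ _ (by push_cast; omega)
      have h2 : symA l (((0 : ℕ) : ℤ) - ((l.length + 1 : ℕ) : ℤ) - 1) = 0 :=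
        symA_zero' _ _ (by push_cast; omega)
      rw [h1, h2]
      simp only [coeff_add, coeff_C_mul, coeff_X_mul_zero, ih]
      rw [show ((0 : ℕ) : ℤ) - ((l.length + 1 : ℕ) : ℤ) + 1 = ((0 : ℕ) : ℤ) - l.length by
        push_cast; ring]
      ring
    | 1 =>
      have h2 : symA l (((1 : ℕ) : ℤ) - ((l.length + 1 : ℕ) : ℤ) - 1) = 0 :=
        symA_zero' _ _ (by push_cast; omega)
      rw [h2]
      simp only [coeff_add, coeff_C_mul, coeff_X_mul_zero, coeff_X_mul, ih,
        show (X * (X * P) : ℂ[X]).coeff 1 =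
          (X * P : ℂ[X]).coeff 0 from coeff_X_mul _ 0,
        show (X * P : ℂ[X]).coeff 1 =
          (P : ℂ[X]).coeff 0 from coeff_X_mul _ 0]
      rw [show ((1 : ℕ) : ℤ) - ((l.length + 1 : ℕ) : ℤ) + 1 = ((1 : ℕ) : ℤ) - l.length by
        push_cast; ring, show ((1 : ℕ) : ℤ) - ((l.length + 1 : ℕ) : ℤ) = ((0 : ℕ) : ℤ) - l.length by
        push_cast; ring]
      ring
    | r + 2 =>
      simp only [coeff_add, coeff_C_mul, coeff_X_mul, ih]
      rw [show ((r + 2 : ℕ) : ℤ) - ((l.length + 1 : ℕ) : ℤ) + 1 = ((r + 2 : ℕ) : ℤ) - l.length by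
        push_cast; ring,
        show ((r + 2 : ℕ) : ℤ) - ((l.length + 1 : ℕ) : ℤ) = ((r + 1 : ℕ) : ℤ) - l.length by
        push_cast; ring,
        show ((r + 1 : ℕ) : ℤ) - l.length - 1 = (r : ℤ) - l.length by
        push_cast; ring]
      ring

theorem tau_zero (s : ℕ) : tauCoef s 0 = 1 := by
  unfold tauCoef
  cases s with
  | zero => simp
  | succ s =>
    have : ((s.factorial : ℕ) : ℂ) ≠ 0 := by exact_mod_cast s.factorial_ne_zero
    have h2 : (s : ℂ) + 1 ≠ 0 := by exact_mod_cast s.succ_ne_zero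
    simp [Nat.factorial_succ]
    field_simp

theorem tau_two (k : ℕ) : tauCoef (2 * (k + 1)) (k + 1) = 2 := by
  unfold tauCoef
  rw [if_neg (by omega), show 2 * (k + 1) - (k + 1) - 1 = k by omega, Nat.sub_self]
  have : ((k.factorial : ℕ) : ℂ) ≠ 0 := by exact_mod_cast k.factorial_ne_zero
  have h2 : (k : ℂ) + 1 ≠ 0 := by exact_mod_cast k.succ_ne_zero
  simp [Nat.factorial_succ]
  field_simp

theorem tau_rec (d k : ℕ) : tauCoef (d + 1 + 2 * (k + 1)) (k + 1) =
    tauCoef (d + 2 * (k + 1)) (k + 1) + tauCoef (d + 1 + 2 * k) k := by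
  unfold tauCoef
  rw [if_neg (by omega), if_neg (by omega), if_neg (by omega),
    show d + 1 + 2 * (k + 1) - (k + 1) - 1 = d + k + 1 by omega,
    show d + 1 + 2 * (k + 1) - 2 * (k + 1) = d + 1 by omega,
    show d + 2 * (k + 1) - (k + 1) - 1 = d + k by omega,
    show d + 2 * (k + 1) - 2 * (k + 1) = d by omega,
    show d + 1 + 2 * k - k - 1 = d + k by omega,
    show d + 1 + 2 * k - 2 * k = d + 1 by omega]
  have h1 : ((k.factorial : ℕ) : ℂ) ≠ 0 := by exact_mod_cast k.factorial_ne_zero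
  have h2 : (k : ℂ) + 1 ≠ 0 := by exact_mod_cast k.succ_ne_zero
  have h3 : ((d.factorial : ℕ) : ℂ) ≠ 0 := by exact_mod_cast d.factorial_ne_zero
  have h4 : (d : ℂ) + 1 ≠ 0 := by exact_mod_cast d.succ_ne_zero
  simp only [Nat.factorial_succ]
  push_cast
  field_simp
  ring

/-- Telescoping in the boundary case. -/
theorem tele_zero (A : ℤ → ℂ) (hA : ∀ i, A (-i) = A i) (K : ℕ) :
    ∑ k ∈ Finset.range (K + 1), (-1 : ℂ) ^ k * tauCoef (2 * k) k *
      (A (2 * k + 1) + A (2 * k - 1)) = (-1 : ℂ) ^ K * 2 * A (2 * K + 1) := by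
  induction K with
  | zero =>
    have := hA 1
    simp [tau_zero, this]; ring
  | succ K ih =>
    rw [Finset.sum_range_succ, ih, tau_two]
    rw [show 2 * ((K + 1 : ℕ) : ℤ) - 1 = 2 * K + 1 by push_cast; ring]
    ring

theorem tele_succ (A : ℤ → ℂ) (d K : ℕ) :
    ∑ k ∈ Finset.range (K + 1), (-1 : ℂ) ^ k * tauCoef (d + 1 + 2 * k) k *
      (A (d + 2 * k + 2) + A (d + 2 * k)) =
    ∑ k ∈ Finset.range (K + 1), (-1 : ℂ) ^ k * tauCoef (d + 2 * k) k * A (d + 2 * k)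
     + (-1 : ℂ) ^ K * tauCoef (d + 1 + 2 * K) K * A (d + 2 * K + 2) := by
  induction K with
  | zero => simp [tau_zero]; ring
  | succ K ih =>
    rw [Finset.sum_range_succ, ih, Finset.sum_range_succ _ (K + 1), tau_rec]
    rw [show (d : ℤ) + 2 * ((K + 1 : ℕ) : ℤ) = d + 2 * K + 2 by push_cast; ring]
    ring

theorem symB_eq (l : List ℂ) : ∀ d K : ℕ, l.length < d + 2 * (K + 1) →
    symB l d = ∑ k ∈ Finset.range (K + 1),
      (-1 : ℂ) ^ k * tauCoef (d + 2 * k) k * symA l (d + 2 * k) := by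
  induction l with
  | nil =>
    intro d K _
    rw [Finset.sum_range_succ']
    rw [Finset.sum_eq_zero]
    · simp [symA, symB, tau_zero]
    · intro k _
      have : ¬ ((d : ℤ) + 2 * ((k + 1 : ℕ) : ℤ) = 0) := by push_cast; omega
      simp only [symA, if_neg this, mul_zero]
  | cons z l ih =>
    intro d K h
    simp only [List.length_cons] at h
    have ihd := ih d K (by omega)
    cases d with
    | zero =>
      have t := tele_zero (symA l) (symA_neg l) K
      rw [symA_zero l (2 * K + 1) (by omega), mul_zero] at t
      simp only [symB, ihd]
      rw [← add_zero (z * _), ← t, Finset.mul_sum, ← Finset.sum_add_distrib]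
      refine Finset.sum_congr rfl fun k _ => ?_
      simp only [symA, Nat.cast_zero, zero_add]
      ring
    | succ d =>
      have t := tele_succ (symA l) d K
      rw [symA_zero l (d + 2 * K + 2) (by omega), mul_zero, add_zero] at t
      simp only [symB, ihd]
      rw [ih d K (by omega), ← t, Finset.mul_sum, ← Finset.sum_add_distrib]
      refine Finset.sum_congr rfl fun k _ => ?_
      simp only [symA]
      rw [show ((d + 1 : ℕ) : ℤ) + 2 * k + 1 = d + 2 * k + 2 by push_cast; ring,
        show ((d + 1 : ℕ) : ℤ) + 2 * k - 1 = d + 2 * k by push_cast; ring]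
      ring

/-- `e_m(z) = Σ_{k=0}^{⌊m/2⌋} (−1)^k τ_{n−m+2k,k} e_{m−2k}(x,x⁻¹)` where `z_j = x_j + x_j⁻¹`. -/
theorem esymm_z_eq_sum_esymm_symplectic (n m : ℕ) (hn : 1 ≤ n) (hm : m ≤ n)
    (x : Fin n → ℂ) (hx : ∀ j, x j ≠ 0)
    (z : Fin n → ℂ) (hz : ∀ j, z j = x j + (x j)⁻¹) :
    esymmVal m z
      = ∑ k ∈ Finset.range (m / 2 + 1),
          (-1 : ℂ) ^ k * tauCoef (n - m + 2 * k) k * esymmVal (m - 2 * k) (sympAlph x) := by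
  have hB := symB_eq (List.ofFn z) (n - m) (m / 2) (by rw [List.length_ofFn]; omega)
  have h1 : esymmVal m z = symB (List.ofFn z) (n - m) := by
    have := esymmVal_eq_coeff z (n - m) (by simp)
    rw [Fintype.card_fin, Nat.sub_sub_self hm] at this
    rw [this, ← symB_coeff, List.map_ofFn, List.prod_ofFn]
    rfl
  rw [h1, hB]
  refine Finset.sum_congr rfl fun k hk => ?_
  have hk' : 2 * k ≤ m := by
    have := Finset.mem_range.1 hk
    omega
  congr 1
  have := esymmVal_eq_coeff (sympAlph x) (2 * n - (m - 2 * k)) (by simp; omega)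
  rw [Fintype.card_sum, Fintype.card_fin, show n + n - (2 * n - (m - 2 * k)) = m - 2 * k by omega]
    at this
  rw [this, Fintype.prod_sum_type, ← Finset.prod_mul_distrib]
  have hA := symA_coeff (List.ofFn z) (2 * n - (m - 2 * k))
  rw [List.map_ofFn, List.prod_ofFn, List.length_ofFn] at hA
  rw [show ((n - m : ℕ) : ℤ) + 2 * k = ((2 * n - (m - 2 * k) : ℕ) : ℤ) - n by omega, ← hA]
  congr 1
  refine Finset.prod_congr rfl fun j _ => ?_
  have hc : (Polynomial.C (x j) * Polynomial.C (x j)⁻¹ : Polynomial ℂ) = 1 := by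
    rw [← Polynomial.C_mul, mul_inv_cancel₀ (hx j), Polynomial.C_1]
  simp only [Function.comp, sympAlph, Sum.elim_inl, Sum.elim_inr, hz, Polynomial.C_add]
  linear_combination -hc
end

section
/- Let n ≥ 1, let x_1, …, x_n be nonzero complex numbers, z_j := x_j + x_j^{-1}, and let 0 ≤ m ≤ n. Let A be the n × n matrix whose k-th column is (T^monic_n(z_k), …, T^monic_{n−m+1}(z_k), T^monic_{n−m−1}(z_k), …, T^monic_0(z_k)), i.e. the rows are T^monic_r(z_k) for r running from n down to 0 with the value r = n−m omitted. Then e_m(x_1, …, x_n, x_1^{-1}, …, x_n^{-1}) · ∏_{1 ≤ j < k ≤ n} (z_j − z_k) = det A. -/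
open Polynomial in
/-- The monic Chebyshev polynomials as polynomials. -/
noncomputable def qpoly : ℕ → ℂ[X]
  | 0 => 1
  | 1 => X
  | 2 => X ^ 2 - C 2
  | (n+3) => X * qpoly (n+2) - qpoly (n+1)

open Polynomial in
theorem qpoly_monic_deg (n : ℕ) : (qpoly n).Monic ∧ (qpoly n).natDegree = n := by
  induction n using Nat.strong_induction_on with
  | _ n ih =>
    match n, ih with
    | 0, _ => simp [qpoly]
    | 1, _ => simp [qpoly, monic_X]
    | 2, _ =>
      refine ⟨?_, ?_⟩
      · exact monic_X_pow_sub_C _ (by norm_num)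
      · exact natDegree_X_pow_sub_C
    | k+3, ih =>
      obtain ⟨m2, d2⟩ := ih (k+2) (by omega)
      obtain ⟨m1, d1⟩ := ih (k+1) (by omega)
      have hm : (X * qpoly (k+2)).Monic := monic_X.mul m2
      have hd : (X * qpoly (k+2)).natDegree = k + 3 := by
        rw [monic_X.natDegree_mul m2, d2, natDegree_X]; omega
      have hlt : (qpoly (k+1)).natDegree < (X * qpoly (k+2)).natDegree := by
        rw [hd, d1]; omega
      refine ⟨?_, ?_⟩
      · exact hm.sub_of_left (degree_lt_degree hlt)
      · change (X * qpoly (k+2) - qpoly (k+1)).natDegree = _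
        rw [natDegree_sub_eq_left_of_natDegree_lt hlt, hd]

open Polynomial in
theorem qpoly_eval (n : ℕ) (u : ℂ) : (qpoly n).eval u = tmonic n u := by
  induction n using Nat.strong_induction_on with
  | _ n ih =>
    match n, ih with
    | 0, _ => simp [qpoly, tmonic]
    | 1, _ => simp [qpoly, tmonic, chebT]; ring
    | 2, _ => simp [qpoly, tmonic, chebT]; ring
    | k+3, ih =>
      have h2 := ih (k+2) (by omega)
      have h1 := ih (k+1) (by omega)
      change (X * qpoly (k+2) - qpoly (k+1)).eval u = _
      rw [eval_sub, eval_mul, eval_X, h1, h2]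
      simp only [tmonic, Nat.succ_ne_zero, if_false, Nat.add_eq_zero_iff, and_false, one_ne_zero,
        OfNat.ofNat_ne_zero]
      rw [show chebT (k+3) (u/2) = 2 * (u/2) * chebT (k+2) (u/2) - chebT (k+1) (u/2) from rfl]
      ring

theorem tmonic_add_inv (n : ℕ) (y : ℂ) (hy : y ≠ 0) :
    tmonic n (y + y⁻¹) = y ^ n + if n = 0 then 0 else (y⁻¹) ^ n := by
  have key : ∀ k, 2 * chebT k ((y + y⁻¹) / 2) = y ^ k + (y⁻¹) ^ k ∧
      2 * chebT (k+1) ((y + y⁻¹) / 2) = y ^ (k+1) + (y⁻¹) ^ (k+1) := by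
    intro k
    induction k with
    | zero => constructor <;> simp [chebT] <;> ring
    | succ k ih =>
      refine ⟨ih.2, ?_⟩
      rw [show chebT (k+1+1) ((y + y⁻¹) / 2) = 2 * ((y + y⁻¹) / 2) * chebT (k+1) ((y + y⁻¹) / 2)
        - chebT k ((y + y⁻¹) / 2) from rfl]
      have h : y * y⁻¹ = 1 := mul_inv_cancel₀ hy
      linear_combination (y + y⁻¹) * ih.2 - ih.1 + (y ^ k + (y⁻¹)^k) * h
  rcases Nat.eq_zero_or_pos n with rfl | h
  · simp [tmonic]
  · simp [tmonic, h.ne', (key n).1]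

theorem det_tmonic (n : ℕ) (v : Fin n → ℂ) :
    (Matrix.of fun j k : Fin n => tmonic (n - 1 - (j : ℕ)) (v k)).det
      = ∏ j : Fin n, ∏ k ∈ Finset.Ioi j, (v j - v k) := by
  have h1 := Matrix.det_projVandermonde (fun _ : Fin n => (1:ℂ)) v
  simp only [one_mul] at h1
  rw [← h1]
  have h2 : Matrix.projVandermonde (fun _ : Fin n => (1:ℂ)) v
      = (Matrix.vandermonde (v ∘ Fin.rev)).submatrix Fin.revPerm Fin.revPerm := by
    ext i j
    simp [Matrix.projVandermonde_apply]
  rw [h2, Matrix.det_submatrix_equiv_self,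
    Matrix.det_eval_matrixOfPolynomials_eq_det_vandermonde _ (fun i : Fin n => qpoly i)
      (fun i => (qpoly_monic_deg i).2) (fun i => (qpoly_monic_deg i).1),
    ← Matrix.det_submatrix_equiv_self Fin.revPerm, ← Matrix.det_transpose]
  congr 1
  ext i j
  simp [qpoly_eval, Fin.val_rev, Nat.sub_sub, Nat.add_comm]
  congr 1
  omega

theorem expand (n : ℕ) (z : Fin n → ℂ) (w : ℂ) :
    (∏ i, (w - z i)) * (∏ j : Fin n, ∏ k ∈ Finset.Ioi j, (z j - z k)) =
    ∑ i : Fin (n+1), (-1) ^ (i : ℕ) * tmonic (n - i) w *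
      (Matrix.of fun j k : Fin n =>
          tmonic (if (j : ℕ) < i then n - (j : ℕ) else n - 1 - (j : ℕ)) (z k)).det := by
  have h := det_tmonic (n+1) (Fin.cons w z)
  rw [Fin.prod_univ_succ] at h
  simp only [Fin.Ioi_zero_eq_map, Finset.prod_map, Fin.cons_zero, Fin.Ioi_succ, Fin.cons_succ,
    Fin.coe_succEmb] at h
  rw [← h, Matrix.det_succ_column_zero]
  refine Finset.sum_congr rfl fun i _ => ?_
  congr 1
  congr 1
  ext j k
  simp only [Matrix.submatrix_apply, Matrix.of_apply, Fin.cons_succ]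
  congr 1
  simp only [Fin.succAbove, Fin.lt_def, Fin.val_castSucc]
  split_ifs <;> simp <;> omega

open Polynomial in
theorem esymm_symplectic_mul_vandermonde_eq_det (n m : ℕ) (hn : 1 ≤ n) (hm : m ≤ n)
    (x : Fin n → ℂ) (hx : ∀ j, x j ≠ 0)
    (z : Fin n → ℂ) (hz : ∀ j, z j = x j + (x j)⁻¹) :
    esymmVal m (sympAlph x) * (∏ j : Fin n, ∏ k ∈ Finset.Ioi j, (z j - z k))
      = Matrix.det (Matrix.of fun j k : Fin n =>
          tmonic (if (j : ℕ) < m then n - (j : ℕ) else n - 1 - (j : ℕ)) (z k)) := by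
  have hpoly : (∑ i : Fin (n+1), C ((-1) ^ (i : ℕ) *
      (Matrix.of fun j k : Fin n =>
          tmonic (if (j : ℕ) < i then n - (j : ℕ) else n - 1 - (j : ℕ)) (z k)).det) *
        (X ^ (2 * n - i) + if (i : ℕ) < n then X ^ (i : ℕ) else 0) : ℂ[X]) =
      C (∏ j : Fin n, ∏ k ∈ Finset.Ioi j, (z j - z k)) *
        ∏ i : Fin n ⊕ Fin n, (X + C (- sympAlph x i)) := by
    apply eq_of_infinite_eval_eq
    refine Set.Infinite.mono (s := {0}ᶜ) ?_ (Set.finite_singleton 0).infinite_compl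
    intro y hy
    have hy : y ≠ 0 := by simpa using hy
    have h := expand n z (y + y⁻¹)
    have hprod : y ^ n * ∏ i, (y + y⁻¹ - z i) = (∏ i, (y - x i)) * ∏ i, (y - (x i)⁻¹) := by
      rw [← Finset.prod_mul_distrib, ← Fin.prod_const, ← Finset.prod_mul_distrib]
      refine Finset.prod_congr rfl fun i _ => ?_
      rw [hz]
      have := hx i
      field_simp
      ring
    simp only [Set.mem_ofPred_eq, eval_finsetSum, eval_mul, eval_C, eval_add, eval_pow, eval_X,
      eval_prod, Fintype.prod_sum_type, sympAlph, Sum.elim_inl, Sum.elim_inr, ← sub_eq_add_neg]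
    rw [← hprod, mul_left_comm, mul_comm (∏ j : Fin n, ∏ k ∈ Finset.Ioi j, (z j - z k)), h,
      Finset.mul_sum]
    refine Finset.sum_congr rfl fun i _ => ?_
    rw [tmonic_add_inv _ _ hy]
    have hi : (i : ℕ) ≤ n := Nat.lt_succ_iff.mp i.2
    have e1 : y ^ (2 * n - (i:ℕ)) = y ^ n * y ^ (n - (i:ℕ)) := by
      rw [← pow_add]; congr 1; omega
    have e2 : eval y (if (i : ℕ) < n then X ^ (i : ℕ) else 0 : ℂ[X])
        = y ^ n * (if n - (i:ℕ) = 0 then 0 else y⁻¹ ^ (n - (i:ℕ))) := by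
      by_cases hlt : (i : ℕ) < n
      · rw [if_pos hlt, if_neg (by omega), eval_pow, eval_X, inv_pow]
        have : y ^ n = y ^ (i:ℕ) * y ^ (n - (i:ℕ)) := by rw [← pow_add]; congr 1; omega
        rw [this, mul_assoc, mul_inv_cancel₀ (pow_ne_zero _ hy), mul_one]
      · rw [if_neg hlt, if_pos (by omega)]; simp
    rw [e1, e2]
    ring
  have hc := congrArg (fun p => coeff p (2 * n - m)) hpoly
  simp only [finsetSum_coeff, coeff_C_mul] at hc
  rw [Finset.prod_X_add_C_coeff _ _ (by simp; omega),
    Finset.sum_eq_single (⟨m, by omega⟩ : Fin (n+1))] at hc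
  · have hcard : (Finset.univ : Finset (Fin n ⊕ Fin n)).card - (2 * n - m) = m := by
      simp; omega
    have hs : ∑ t ∈ Finset.powersetCard m (Finset.univ : Finset (Fin n ⊕ Fin n)),
        ∏ i ∈ t, (- sympAlph x i) = (-1) ^ m * esymmVal m (sympAlph x) := by
      rw [esymmVal, Finset.mul_sum]
      refine Finset.sum_congr rfl fun t ht => ?_
      rw [Finset.prod_neg, (Finset.mem_powersetCard.mp ht).2]
    rw [hcard, hs] at hc
    have h1 : (X ^ (2 * n - m) + if m < n then X ^ m else 0 : ℂ[X]).coeff (2 * n - m) = 1 := by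
      rw [coeff_add, coeff_X_pow, if_pos rfl]
      split_ifs with h
      · rw [coeff_X_pow, if_neg (by omega), add_zero]
      · simp
    simp only [h1, mul_one] at hc
    have hne : ((-1 : ℂ)) ^ m ≠ 0 := pow_ne_zero _ (by norm_num)
    apply mul_left_cancel₀ hne
    rw [hc]; ring
  · intro i _ hi
    have hi' : (i : ℕ) ≠ m := fun h => hi (Fin.ext h)
    have := i.2
    rw [coeff_add, coeff_X_pow, if_neg (by omega)]
    split_ifs with h
    · rw [coeff_X_pow, if_neg (by omega)]; simp
    · simp
  · simp
end

section
/- Let n ≥ 1, let x_1, …, x_n be nonzero complex numbers, z_j := x_j + x_j^{-1}, and let m ≥ 0. Then h_m(x_1, …, x_n, x_1^{-1}, …, x_n^{-1}) = Σ_{k=0}^{⌊m/2⌋} (−1)^k · binom(n + m − k − 1, k) · h_{m−2k}(z_1, …, z_n). -/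
open PowerSeries in
/-- The linear transform `f ↦ Σ_r f_r t^r (1+t²)^{-n-r}`. -/
noncomputable def phiT (n : ℕ) (f : PowerSeries ℂ) : PowerSeries ℂ :=
  PowerSeries.mk fun m => ∑ k ∈ Finset.range (m / 2 + 1),
    (-1 : ℂ) ^ k * ((Nat.multichoose (n + (m - 2 * k)) k : ℕ) : ℂ) * coeff (m - 2 * k) f

open PowerSeries in
lemma phiT_sub (n : ℕ) (f g : PowerSeries ℂ) : phiT n (f - g) = phiT n f - phiT n g := by
  ext m
  simp [phiT, mul_sub, Finset.sum_sub_distrib]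

open PowerSeries in
lemma phiT_C_mul (n : ℕ) (a : ℂ) (f : PowerSeries ℂ) : phiT n (C a * f) = C a * phiT n f := by
  ext m
  simp only [phiT, coeff_mk, coeff_C_mul, Finset.mul_sum]
  exact Finset.sum_congr rfl fun _ _ => by ring

open PowerSeries in
lemma phiT_X_mul (n : ℕ) (f : PowerSeries ℂ) : phiT n (X * f) = X * phiT (n + 1) f := by
  ext m
  rcases m with _ | m
  · simp [phiT]
  rw [coeff_succ_X_mul]
  simp only [phiT, coeff_mk]
  symm
  have hsub : Finset.range (m / 2 + 1) ⊆ Finset.range ((m + 1) / 2 + 1) := by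
    intro k; simp only [Finset.mem_range]; omega
  rw [← Finset.sum_subset hsub]
  · refine Finset.sum_congr rfl fun k hk => ?_
    rw [Finset.mem_range] at hk
    have h1 : m + 1 - 2 * k = (m - 2 * k) + 1 := by omega
    rw [h1, coeff_succ_X_mul]
    congr 4
    omega
  · intro k hk hk'
    simp only [Finset.mem_range] at hk hk'
    have h1 : m + 1 - 2 * k = 0 := by omega
    simp [h1]

open PowerSeries in
lemma phiT_succ (n : ℕ) (f : PowerSeries ℂ) :
    (1 + X ^ 2) * phiT (n + 1) f = phiT n f := by
  ext m
  rw [add_mul, one_mul, map_add]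
  rcases m with _ | _ | m
  · simp [phiT, coeff_X_pow_mul']
  · simp [phiT, coeff_X_pow_mul']
  · rw [show m + 1 + 1 = m + 2 from rfl, coeff_X_pow_mul]
    simp only [phiT, coeff_mk]
    rw [show (m + 2) / 2 = m / 2 + 1 by omega, Finset.sum_range_succ' _ (m / 2 + 1),
      Finset.sum_range_succ' _ (m / 2 + 1), add_right_comm, ← Finset.sum_add_distrib]
    congr 1
    · refine Finset.sum_congr rfl fun k hk => ?_
      rw [show m + 2 - 2 * (k + 1) = m - 2 * k by omega,
        show n + 1 + (m - 2 * k) = n + (m - 2 * k) + 1 by omega, Nat.multichoose_succ_succ]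
      push_cast
      ring
    · simp

open PowerSeries in
lemma phiT_zero_one : phiT 0 1 = 1 := by
  ext m
  simp only [phiT, coeff_mk, coeff_one]
  rcases Nat.eq_zero_or_pos m with rfl | hm
  · simp
  rw [if_neg hm.ne']
  refine Finset.sum_eq_zero fun k hk => ?_
  split_ifs with h
  · rw [h]
    obtain ⟨j, rfl⟩ : ∃ j, k = j + 1 := ⟨k - 1, by omega⟩
    simp
  · simp

open PowerSeries in
lemma geom_mul (a : ℂ) : (PowerSeries.mk fun k => a ^ k) * (1 - C a * X) = 1 := by
  ext m
  rw [mul_sub, mul_one, map_sub, mul_left_comm, coeff_C_mul]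
  rcases m with _ | m
  · simp
  · rw [coeff_succ_mul_X]
    simp [coeff_one, pow_succ']

open PowerSeries in
lemma hsymm_gen {ι : Type*} [Fintype ι] [DecidableEq ι] (y : ι → ℂ) :
    (PowerSeries.mk fun m => hsymmVal m y) = ∏ i, PowerSeries.mk fun k => y i ^ k := by
  ext m
  rw [coeff_mk, coeff_prod, hsymmVal]
  refine Finset.sum_bij' (fun α _ => Finsupp.equivFunOnFinite.symm α) (fun l _ => ⇑l)
    ?_ ?_ ?_ ?_ ?_
  · intro α hα
    simp at hα
    simp [Finset.mem_finsuppAntidiag, hα.2]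
  · intro l hl
    simp [Finset.mem_finsuppAntidiag] at hl
    simp only [Finset.mem_filter, Fintype.mem_piFinset, Finset.mem_range]
    refine ⟨fun i => ?_, hl⟩
    have := Finset.single_le_sum (f := fun i => l i) (fun _ _ => Nat.zero_le _) (Finset.mem_univ i)
    exact Nat.lt_succ_of_le (this.trans (le_of_eq hl))
  · intro α hα; rfl
  · intro l hl; ext; rfl
  · intro α hα; simp

open PowerSeries in
lemma phiT_prod {ι : Type*} [DecidableEq ι] (z : ι → ℂ) (s : Finset ι) :
    phiT s.card (∏ i ∈ s, PowerSeries.mk fun k => z i ^ k)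
      * ∏ i ∈ s, (1 + X ^ 2 - C (z i) * X) = 1 := by
  induction s using Finset.induction_on with
  | empty => simpa using phiT_zero_one
  | insert a s ha ih =>
    rw [Finset.prod_insert ha, Finset.prod_insert ha, Finset.card_insert_of_notMem ha]
    set G := ∏ i ∈ s, PowerSeries.mk fun k => z i ^ k
    set F := (PowerSeries.mk fun k => z a ^ k) * G with hF
    have h1 : F - C (z a) * (X * F) = G := by
      calc F - C (z a) * (X * F) = ((PowerSeries.mk fun k => z a ^ k) * (1 - C (z a) * X)) * G := by
            rw [hF]; ring
        _ = G := by rw [geom_mul, one_mul]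
    have h2 := congrArg (phiT s.card) h1
    rw [phiT_sub, phiT_C_mul, phiT_X_mul, ← phiT_succ] at h2
    rw [← h2] at ih
    refine Eq.trans ?_ ih
    ring

/-- `h_m(x,x⁻¹) = Σ_{k=0}^{⌊m/2⌋} (−1)^k C(n+m−k−1, k) h_{m−2k}(z)` where `z_j = x_j + x_j⁻¹`. -/
theorem hsymm_symplectic_eq_sum_hsymm_z (n m : ℕ) (hn : 1 ≤ n)
    (x : Fin n → ℂ) (hx : ∀ j, x j ≠ 0)
    (z : Fin n → ℂ) (hz : ∀ j, z j = x j + (x j)⁻¹) :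
    hsymmVal m (sympAlph x)
      = ∑ k ∈ Finset.range (m / 2 + 1),
          (-1 : ℂ) ^ k * (((n + m - k - 1).choose k : ℕ) : ℂ) * hsymmVal (m - 2 * k) z := by
  have hL : (PowerSeries.mk fun m => hsymmVal m (sympAlph x))
      * ∏ i, (1 + PowerSeries.X ^ 2 - PowerSeries.C (z i) * PowerSeries.X) = 1 := by
    rw [hsymm_gen, Fintype.prod_sum_type, ← Finset.prod_mul_distrib, ← Finset.prod_mul_distrib]
    refine Finset.prod_eq_one fun i _ => ?_
    have hfac : (1 + PowerSeries.X ^ 2 - PowerSeries.C (z i) * PowerSeries.X : PowerSeries ℂ)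
        = (1 - PowerSeries.C (x i) * PowerSeries.X)
          * (1 - PowerSeries.C (x i)⁻¹ * PowerSeries.X) := by
      have h1 : PowerSeries.C (x i) * PowerSeries.C (x i)⁻¹ = (1 : PowerSeries ℂ) := by
        rw [← map_mul, mul_inv_cancel₀ (hx i), map_one]
      rw [hz i, map_add]
      linear_combination (-PowerSeries.X ^ 2) * h1
    rw [hfac]
    simp only [sympAlph, Sum.elim_inl, Sum.elim_inr]
    rw [mul_mul_mul_comm, geom_mul, geom_mul, one_mul]
  have hR := phiT_prod z Finset.univ
  rw [← hsymm_gen, Finset.card_univ, Fintype.card_fin] at hR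
  have hEq := mul_right_cancel₀ (right_ne_zero_of_mul_eq_one hL) (hL.trans hR.symm)
  have hm := congrArg (PowerSeries.coeff m) hEq
  simp only [phiT, PowerSeries.coeff_mk] at hm
  rw [hm]
  refine Finset.sum_congr rfl fun k hk => ?_
  rw [Finset.mem_range] at hk
  rw [Nat.multichoose_eq, show n + (m - 2 * k) + k - 1 = n + m - k - 1 by omega]
end

section
/- Let n ≥ 1, let x_1, …, x_n be nonzero complex numbers such that the numbers z_j := x_j + x_j^{-1} are pairwise distinct, and let m ≥ 0. Then h_m(x_1, …, x_n, x_1^{-1}, …, x_n^{-1}) = Σ_{j=1}^{n} U_{m+n−1}(z_j / 2) / ∏_{k ∈ {1,…,n}, k ≠ j} (z_j − z_k). -/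
open PowerSeries in
lemma aux_geo (y : ℂ) : (PowerSeries.mk (fun r => y ^ r)) * (1 - PowerSeries.C y * PowerSeries.X) = 1 := by
  ext r
  cases r with
  | zero => simp
  | succ r =>
    rw [mul_sub, mul_one, map_sub, ← mul_assoc, coeff_succ_mul_X, mul_comm, coeff_C_mul, coeff_mk,
      coeff_mk, coeff_one]
    simp [pow_succ, mul_comm]

open PowerSeries in
lemma aux_cheb (z : ℂ) : (PowerSeries.mk (fun r => chebU r (z / 2))) *
    (1 - PowerSeries.C z * PowerSeries.X + PowerSeries.X ^ 2) = 1 := by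
  have e : (PowerSeries.mk (fun r => chebU r (z / 2))) *
      (1 - PowerSeries.C z * PowerSeries.X + PowerSeries.X ^ 2) =
      PowerSeries.mk (fun r => chebU r (z / 2))
      - PowerSeries.C z * (PowerSeries.mk (fun r => chebU r (z / 2))) * PowerSeries.X
      + PowerSeries.mk (fun r => chebU r (z / 2)) * PowerSeries.X * PowerSeries.X := by ring
  rw [e]
  ext r
  match r with
  | 0 => simp [chebU]
  | 1 =>
    rw [map_add, map_sub, coeff_succ_mul_X, coeff_succ_mul_X, coeff_C_mul, coeff_mk, coeff_mk,
      coeff_one]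
    simp [chebU]
    ring
  | r + 2 =>
    rw [map_add, map_sub, coeff_succ_mul_X, coeff_succ_mul_X, coeff_succ_mul_X, coeff_C_mul,
      coeff_mk, coeff_mk, coeff_mk, coeff_one]
    simp [chebU]
    ring

lemma aux_gen {ι : Type*} [Fintype ι] [DecidableEq ι] (m : ℕ) (y : ι → ℂ) :
    hsymmVal m y = PowerSeries.coeff m (∏ i, PowerSeries.mk (fun r => y i ^ r)) := by
  rw [PowerSeries.coeff_prod, hsymmVal]
  simp only [PowerSeries.coeff_mk]
  symm
  refine Finset.sum_bij (fun l _ => (l : ι → ℕ)) ?_ ?_ ?_ ?_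
  · intro l hl
    rw [Finset.mem_finsuppAntidiag] at hl
    simp only [Finset.mem_filter, Fintype.mem_piFinset, Finset.mem_range]
    refine ⟨fun i => ?_, hl.1⟩
    have := Finset.single_le_sum (f := fun i => l i) (fun _ _ => Nat.zero_le _) (Finset.mem_univ i)
    have h1 := hl.1
    exact Nat.lt_succ_of_le (this.trans h1.le)
  · intro a _ b _ h
    exact DFunLike.coe_injective h
  · intro f hf
    simp only [Finset.mem_filter] at hf
    exact ⟨Finsupp.equivFunOnFinite.symm f, by
      rw [Finset.mem_finsuppAntidiag]
      exact ⟨hf.2, by simp⟩, rfl⟩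
  · intro l _
    rfl

lemma aux_lag {n : ℕ} (hn : 1 ≤ n) (z : Fin n → ℂ)
    (hdist : ∀ j k : Fin n, j ≠ k → z j ≠ z k) (a t : ℂ) (ht : t ≠ 0) :
    ∑ j : Fin n, (∏ k ∈ Finset.univ.erase j, (z j - z k))⁻¹ *
      ∏ k ∈ Finset.univ.erase j, (a - z k * t) = t ^ (n - 1) := by
  have hs : (Finset.univ : Finset (Fin n)).Nonempty := ⟨⟨0, hn⟩, Finset.mem_univ _⟩
  have h := Lagrange.sum_basis (s := Finset.univ) (v := z)
    (fun j _ k _ h => by by_contra hne; exact hdist j k hne h) hs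
  have h2 := congrArg (fun p => Polynomial.eval (a / t) p * t ^ (n - 1)) h
  simp only [Polynomial.eval_finsetSum, Lagrange.basis, Polynomial.eval_prod,
    Lagrange.basisDivisor, Polynomial.eval_mul, Polynomial.eval_C, Polynomial.eval_sub,
    Polynomial.eval_X, Polynomial.eval_one, one_mul] at h2
  rw [← h2, Finset.sum_mul]
  refine Finset.sum_congr rfl fun j _ => ?_
  have hc : t ^ (n - 1) = ∏ k ∈ Finset.univ.erase j, t := by simp
  rw [hc, ← Finset.prod_mul_distrib, ← Finset.prod_inv_distrib, ← Finset.prod_mul_distrib]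
  refine Finset.prod_congr rfl fun k _ => ?_
  field_simp

lemma aux_poly {n : ℕ} (hn : 1 ≤ n) (z : Fin n → ℂ)
    (hdist : ∀ j k : Fin n, j ≠ k → z j ≠ z k) :
    ∑ j : Fin n, Polynomial.C (∏ k ∈ Finset.univ.erase j, (z j - z k))⁻¹ *
      ∏ k ∈ Finset.univ.erase j, (1 - Polynomial.C (z k) * Polynomial.X + Polynomial.X ^ 2)
      = (Polynomial.X : Polynomial ℂ) ^ (n - 1) := by
  apply Polynomial.eq_of_infinite_eval_eq
  refine Set.Infinite.mono (s := {0}ᶜ) ?_ (Set.finite_singleton (0 : ℂ)).infinite_compl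
  intro t ht
  have := aux_lag hn z hdist (1 + t ^ 2) t ht
  simp only [Set.mem_ofPred_eq, Polynomial.eval_finsetSum, Polynomial.eval_mul, Polynomial.eval_C,
    Polynomial.eval_prod, Polynomial.eval_add, Polynomial.eval_sub, Polynomial.eval_one,
    Polynomial.eval_pow, Polynomial.eval_X]
  rw [← this]
  refine Finset.sum_congr rfl fun j _ => ?_
  congr 1
  refine Finset.prod_congr rfl fun k _ => ?_
  ring

lemma aux_series {n : ℕ} (hn : 1 ≤ n) (z : Fin n → ℂ)
    (hdist : ∀ j k : Fin n, j ≠ k → z j ≠ z k) :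
    ∑ j : Fin n, PowerSeries.C (∏ k ∈ Finset.univ.erase j, (z j - z k))⁻¹ *
      PowerSeries.mk (fun r => chebU r (z j / 2))
      = PowerSeries.X ^ (n - 1) * ∏ j, PowerSeries.mk (fun r => chebU r (z j / 2)) := by
  have h := congrArg (Polynomial.coeToPowerSeries.ringHom (R := ℂ)) (aux_poly hn z hdist)
  simp only [map_sum, map_mul, map_prod, map_add, map_sub, map_one, map_pow,
    Polynomial.coeToPowerSeries.ringHom_apply, Polynomial.coe_C, Polynomial.coe_X] at h
  rw [← h, Finset.sum_mul]
  refine Finset.sum_congr rfl fun j _ => ?_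
  rw [← Finset.mul_prod_erase Finset.univ _ (Finset.mem_univ j), mul_assoc]
  congr 1
  rw [mul_left_comm, ← Finset.prod_mul_distrib, Finset.prod_eq_one, mul_one]
  intro k _
  rw [mul_comm, aux_cheb]

lemma aux_pair (x : ℂ) (hx : x ≠ 0) : (PowerSeries.mk (fun r => x ^ r)) *
    (PowerSeries.mk (fun r => x⁻¹ ^ r)) = PowerSeries.mk (fun r => chebU r ((x + x⁻¹) / 2)) := by
  have h1 := aux_geo x
  have h2 := aux_geo x⁻¹
  have h3 := aux_cheb (x + x⁻¹)
  have h4 : (PowerSeries.C x : PowerSeries ℂ) * PowerSeries.C x⁻¹ = 1 := by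
    rw [← map_mul, mul_inv_cancel₀ hx, map_one]
  rw [map_add] at h3
  generalize (PowerSeries.mk (fun r => x ^ r)) = A at *
  generalize (PowerSeries.mk (fun r => x⁻¹ ^ r)) = B at *
  generalize PowerSeries.mk (fun r => chebU r ((x + x⁻¹) / 2)) = G at *
  generalize (PowerSeries.C x : PowerSeries ℂ) = a at *
  generalize (PowerSeries.C x⁻¹ : PowerSeries ℂ) = b at *
  have h5 : (A * B) * (1 - (a + b) * PowerSeries.X + PowerSeries.X ^ 2) = 1 := by
    calc _ = (A * (1 - a * PowerSeries.X)) * (B * (1 - b * PowerSeries.X)) := by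
          linear_combination (-A * B * PowerSeries.X ^ 2) * h4
      _ = 1 := by rw [h1, h2, one_mul]
  linear_combination G * h5 - A * B * h3

/-- `h_m(x,x⁻¹) = Σ_j U_{m+n−1}(z_j/2) / ∏_{k≠j}(z_j − z_k)` for pairwise distinct `z_j`. -/
theorem hsymm_symplectic_eq_sum_chebU_quotients (n m : ℕ) (hn : 1 ≤ n)
    (x : Fin n → ℂ) (hx : ∀ j, x j ≠ 0)
    (z : Fin n → ℂ) (hz : ∀ j, z j = x j + (x j)⁻¹)
    (hdist : ∀ j k : Fin n, j ≠ k → z j ≠ z k) :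
    hsymmVal m (sympAlph x)
      = ∑ j : Fin n, chebU (m + n - 1) (z j / 2) / ∏ k ∈ Finset.univ.erase j, (z j - z k) := by
  have key : ∏ i, PowerSeries.mk (fun r => sympAlph x i ^ r)
      = ∏ j, PowerSeries.mk (fun r => chebU r (z j / 2)) := by
    rw [Fintype.prod_sum_type, ← Finset.prod_mul_distrib]
    refine Finset.prod_congr rfl fun j _ => ?_
    simp only [sympAlph, Sum.elim_inl, Sum.elim_inr]
    rw [aux_pair _ (hx j), hz]
  have h := congrArg (PowerSeries.coeff (m + (n - 1))) (aux_series hn z hdist)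
  rw [mul_comm (PowerSeries.X ^ (n - 1)), PowerSeries.coeff_mul_X_pow] at h
  rw [aux_gen, key, ← h, map_sum]
  refine Finset.sum_congr rfl fun j _ => ?_
  rw [PowerSeries.coeff_C_mul, PowerSeries.coeff_mk, Nat.add_sub_assoc hn, mul_comm, ← div_eq_mul_inv]
end

section
/- Let n ≥ 1, let x_1, …, x_n be nonzero complex numbers, z_j := x_j + x_j^{-1}, and let m ≥ 0. Then h_m(x_1, …, x_n, x_1^{-1}, …, x_n^{-1}) = Σ ∏_{j=1}^{n} U_{α_j}(z_j / 2), where the sum is over all n-tuples (α_1, …, α_n) of nonnegative integers with α_1 + ⋯ + α_n = m. -/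
open PowerSeries in
lemma coeff_prod_mk_aux {ι : Type*} [Fintype ι] [DecidableEq ι] (m : ℕ) (f : ι → ℕ → ℂ) :
    ∑ α ∈ (Fintype.piFinset fun _ : ι => Finset.range (m+1)).filter (fun α => ∑ i, α i = m),
      ∏ i, f i (α i) = PowerSeries.coeff m (∏ i, PowerSeries.mk (f i)) := by
  rw [PowerSeries.coeff_prod]
  symm
  refine Finset.sum_bij (fun (a : ι →₀ ℕ) _ => (a : ι → ℕ)) ?_ ?_ ?_ ?_
  · intro a ha
    have h : ∑ i, a i = m := (Finset.mem_finsuppAntidiag.1 ha).1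
    simp only [Finset.mem_filter, Fintype.mem_piFinset, Finset.mem_range]
    refine ⟨fun i => ?_, h⟩
    have := Finset.single_le_sum (f := fun i => a i) (fun i _ => Nat.zero_le _) (Finset.mem_univ i)
    omega
  · intro a _ b _ h
    exact DFunLike.coe_injective h
  · intro b hb
    refine ⟨Finsupp.equivFunOnFinite.symm b, ?_, ?_⟩
    · rw [Finset.mem_finsuppAntidiag]
      refine ⟨?_, Finset.subset_univ _⟩
      simpa using (Finset.mem_filter.1 hb).2
    · simp
  · intro a _
    simp

lemma mk_pow_mul_aux (a : ℂ) :
    PowerSeries.mk (fun k => a ^ k) * (1 - PowerSeries.C a * PowerSeries.X) = 1 := by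
  ext k
  rw [mul_sub, mul_one, mul_left_comm, map_sub, PowerSeries.coeff_C_mul]
  cases k with
  | zero => simp
  | succ k => simp [PowerSeries.coeff_succ_mul_X, PowerSeries.coeff_one, pow_succ']

lemma mk_chebU_mul_aux (w : ℂ) :
    PowerSeries.mk (fun k => chebU k (w / 2)) *
      (1 - PowerSeries.C w * PowerSeries.X + PowerSeries.X * PowerSeries.X) = 1 := by
  ext k
  rw [mul_add, mul_sub, mul_one, mul_left_comm, map_add, map_sub, PowerSeries.coeff_C_mul,
    ← mul_assoc]
  match k with
  | 0 => simp [chebU]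
  | 1 => simp [PowerSeries.coeff_succ_mul_X, PowerSeries.coeff_one, chebU]; ring
  | k+2 =>
    simp [PowerSeries.coeff_succ_mul_X, PowerSeries.coeff_one, chebU]; ring

lemma mk_pow_mul_mk_pow_aux (a : ℂ) (ha : a ≠ 0) :
    PowerSeries.mk (fun k => a ^ k) * PowerSeries.mk (fun k => a⁻¹ ^ k)
      = PowerSeries.mk (fun k => chebU k ((a + a⁻¹) / 2)) := by
  have h1 := mk_pow_mul_aux a
  have h2 := mk_pow_mul_aux a⁻¹
  have h3 := mk_chebU_mul_aux (a + a⁻¹)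
  have h4 : (PowerSeries.C a : PowerSeries ℂ) * PowerSeries.C a⁻¹ = 1 := by
    rw [← map_mul, mul_inv_cancel₀ ha, map_one]
  rw [map_add] at h3
  generalize (PowerSeries.C a : PowerSeries ℂ) = A at *
  generalize (PowerSeries.C a⁻¹ : PowerSeries ℂ) = B at *
  generalize (PowerSeries.X : PowerSeries ℂ) = X at *
  generalize PowerSeries.mk (fun k => a ^ k) = P at *
  generalize PowerSeries.mk (fun k => a⁻¹ ^ k) = Q at *
  generalize PowerSeries.mk (fun k => chebU k ((a + a⁻¹) / 2)) = R at *
  have h5 : (1 - (A + B) * X + X * X) = (1 - A * X) * (1 - B * X) := by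
    linear_combination (-X * X) * h4
  rw [h5] at h3
  calc P * Q = P * Q * (R * ((1 - A * X) * (1 - B * X))) := by rw [h3, mul_one]
    _ = R * (P * (1 - A * X)) * (Q * (1 - B * X)) := by ring
    _ = R := by rw [h1, h2, mul_one, mul_one]

/-- `h_m(x,x⁻¹) = Σ_{α₁+⋯+αₙ=m} ∏_j U_{α_j}(z_j/2)`. -/
theorem hsymm_symplectic_eq_sum_prod_chebU (n m : ℕ) (hn : 1 ≤ n)
    (x : Fin n → ℂ) (hx : ∀ j, x j ≠ 0)
    (z : Fin n → ℂ) (hz : ∀ j, z j = x j + (x j)⁻¹) :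
    hsymmVal m (sympAlph x)
      = ∑ α ∈ (Fintype.piFinset fun _ : Fin n => Finset.range (m + 1)).filter
            (fun α => ∑ j, α j = m),
          ∏ j : Fin n, chebU (α j) (z j / 2) := by
  rw [hsymmVal, coeff_prod_mk_aux m (fun i k => sympAlph x i ^ k),
    coeff_prod_mk_aux m (fun j k => chebU k (z j / 2)), Fintype.prod_sum_type,
    ← Finset.prod_mul_distrib]
  congr 1
  refine Finset.prod_congr rfl fun j _ => ?_
  rw [hz j, ← mk_pow_mul_mk_pow_aux (x j) (hx j)]
  rfl
end

section
/- Let n ≥ 1, let x_1, …, x_n be nonzero complex numbers, z_j := x_j + x_j^{-1}, and let m ≥ 0. Then h_m(z_1, …, z_n) = Σ_{k=0}^{⌊m/2⌋} [ (m+n−1)! · (m+n−2k) / ( k! · (m+n−k)! ) ] · h_{m−2k}(x_1, …, x_n, x_1^{-1}, …, x_n^{-1}). -/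
open Finset in
lemma hs_coeff {ι : Type*} [Fintype ι] [DecidableEq ι] (m : ℕ) (y : ι → ℂ) :
    hsymmVal m y = PowerSeries.coeff m (∏ i, PowerSeries.mk (fun k => y i ^ k)) := by
  rw [PowerSeries.coeff_prod]
  unfold hsymmVal
  refine Finset.sum_bij' (fun α _ => Finsupp.equivFunOnFinite.symm α) (fun l _ => (l : ι → ℕ))
    ?_ ?_ ?_ ?_ ?_
  · intro α h
    simp only [Finset.mem_filter] at h
    simp [Finset.mem_finsuppAntidiag, h.2]
  · intro l h
    simp only [Finset.mem_finsuppAntidiag] at h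
    simp only [Finset.mem_filter, Fintype.mem_piFinset, Finset.mem_range]
    refine ⟨fun i => ?_, h.1⟩
    have := Finset.single_le_sum (f := fun i => l i) (fun _ _ => Nat.zero_le _) (Finset.mem_univ i)
    have h1 : ∑ i, l i = m := h.1
    omega
  · intro α h
    rfl
  · intro l h
    ext i
    rfl
  · intro α h
    simp

/-- the ballot coefficients -/
def bc : ℕ → ℕ → ℤ
  | _, 0 => 1
  | 0, k+1 => 2 * (-1) ^ (k+1)
  | N+1, k+1 => bc N (k+1) + bc N k

lemma bc_zero (N : ℕ) : bc N 0 = 1 := by cases N <;> simp [bc]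

lemma bc_succ (N k : ℕ) : bc (N+1) (k+1) = (N.choose (k+1) : ℤ) - N.choose k := by
  induction N generalizing k with
  | zero => cases k with
    | zero => simp [bc]
    | succ k => simp [bc]; ring
  | succ N ih =>
    rw [bc, ih]
    cases k with
    | zero => simp [bc]
    | succ k =>
      rw [ih, Nat.choose_succ_succ N (k+1), Nat.choose_succ_succ N k]; push_cast; ring

lemma bc_formula (N k : ℕ) (hN : 1 ≤ N) (hk : 2 * k ≤ N) :
    ((N - 1).factorial : ℂ) * ((N - 2 * k : ℕ) : ℂ) /
      ((k.factorial : ℂ) * ((N - k).factorial : ℂ)) = bc N k := by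
  obtain ⟨N, rfl⟩ : ∃ M, N = M + 1 := ⟨N - 1, by omega⟩
  have f1 := fun n : ℕ => (Nat.cast_ne_zero (R := ℂ)).2 (Nat.factorial_ne_zero n)
  cases k with
  | zero =>
    rw [bc_zero]
    have := f1 (N+1)
    simp only [Nat.add_sub_cancel, Nat.mul_zero, Nat.sub_zero, Nat.factorial_zero]
    rw [div_eq_iff (by simpa using this), Nat.factorial_succ]
    push_cast; ring
  | succ k =>
    rw [bc_succ]
    obtain ⟨r, rfl⟩ : ∃ r, N = r + (k + 1) := ⟨N - (k+1), by omega⟩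
    have e1 : r + (k+1) + 1 - 1 = r + (k+1) := by omega
    have e2 : r + (k+1) + 1 - (k+1) = r + 1 := by omega
    have h1 := Nat.add_choose_mul_factorial_mul_factorial r (k+1)
    have h2 := Nat.add_choose_mul_factorial_mul_factorial (r+1) k
    rw [e1, e2, Nat.cast_sub hk]
    have e3 : r + 1 + k = r + (k+1) := by omega
    rw [e3] at h2
    have g1 := congrArg (Nat.cast (R := ℂ)) h1
    have g2 := congrArg (Nat.cast (R := ℂ)) h2
    rw [Nat.factorial_succ] at g1 g2
    rw [div_eq_iff (mul_ne_zero (f1 _) (f1 _)), Nat.factorial_succ, Nat.factorial_succ r]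
    push_cast at *
    linear_combination (-(r:ℂ) - 1) * g1 + (k + 1) * g2

open Finset in
lemma bc_step (n : ℕ) (a a' b b' : ℤ → ℂ) (z : ℂ)
    (ha : ∀ j, a j - z * a (j-1) = a' j) (ha0 : a (-1) = 0)
    (hb : ∀ j, b' j = b j - z * b (j-1) + b (j-2)) (hb0 : ∀ j, j < 0 → b j = 0)
    (H : ∀ m L : ℕ, m < 2 * L → a' m = ∑ k ∈ range L, (bc (m+n) k : ℂ) * b' (m - 2 * k)) :
    ∀ m L : ℕ, m < 2 * L → a m = ∑ k ∈ range L, (bc (m+(n+1)) k : ℂ) * b (m - 2 * k) := by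
  have hz : ∀ m L : ℕ, m < 2 * L →
      a (m-1) = ∑ k ∈ range L, (bc (m+n) k : ℂ) * b (m - 2 * k - 1) →
      a m = ∑ k ∈ range L, (bc (m+(n+1)) k : ℂ) * b (m - 2 * k) := by
    intro m L hL h
    have h1 : a m = a' m + z * a (m-1) := by rw [← ha]; ring
    rw [h1, h, H m L hL, mul_sum, ← sum_add_distrib]
    obtain ⟨L, rfl⟩ : ∃ M, L = M + 1 := ⟨L - 1, by omega⟩
    have h2 : ∀ k ∈ range (L+1), (bc (m+n) k : ℂ) * b' (m - 2 * k) +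
        z * ((bc (m+n) k : ℂ) * b (m - 2 * k - 1)) =
        (bc (m+n) k : ℂ) * b (m - 2 * k) + (bc (m+n) k : ℂ) * b (m - 2 * k - 2) := by
      intro k _
      rw [hb]; ring
    rw [sum_congr rfl h2, sum_add_distrib, sum_range_succ', sum_range_succ _ L,
      hb0 (m - 2 * L - 2) (by push_cast at *; omega), sum_range_succ' _ L, bc_zero, bc_zero]
    have h3 : ∀ k ∈ range L, (bc (m+(n+1)) (k+1) : ℂ) * b (m - 2 * (k+1 : ℕ)) =
      (bc (m+n) (k+1) : ℂ) * b (m - 2 * (k+1 : ℕ)) + (bc (m+n) k : ℂ) * b (m - 2 * k - 2) := by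
      intro k _
      rw [← add_assoc, bc]
      have : (m : ℤ) - 2 * k - 2 = m - 2 * (k+1 : ℕ) := by push_cast; ring
      rw [this]; push_cast; ring
    rw [sum_congr rfl h3, sum_add_distrib]
    ring
  intro m
  induction m with
  | zero =>
    intro L hL
    apply hz 0 L hL
    rw [sum_eq_zero]
    · simpa using ha0
    · intro k _
      rw [hb0 _ (by push_cast; omega), mul_zero]
  | succ m ih =>
    intro L hL
    apply hz (m+1) L hL
    have := ih L (by omega)
    have e : ((m+1 : ℕ) : ℤ) - 1 = m := by push_cast; ring
    rw [e, this]
    refine sum_congr rfl fun k _ => ?_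
    have e2 : ((m+1 : ℕ) : ℤ) - 2 * k - 1 = m - 2 * k := by push_cast; ring
    rw [e2, show m + (n+1) = m + 1 + n by ring]

/-- coefficients extended by zero to negative indices -/
noncomputable def cz (f : PowerSeries ℂ) (j : ℤ) : ℂ :=
  if j < 0 then 0 else PowerSeries.coeff j.toNat f

lemma cz_neg (f : PowerSeries ℂ) (j : ℤ) (h : j < 0) : cz f j = 0 := by simp [cz, h]

lemma cz_nat (f : PowerSeries ℂ) (m : ℕ) : cz f m = PowerSeries.coeff m f := by simp [cz]

lemma cz_X (f : PowerSeries ℂ) (j : ℤ) : cz (PowerSeries.X * f) j = cz f (j-1) := by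
  rcases lt_or_ge j 0 with h | h
  · rw [cz_neg _ _ h, cz_neg _ _ (by omega)]
  · lift j to ℕ using h
    cases j with
    | zero => rw [cz_nat, cz_neg _ _ (by simp)]; simp
    | succ j =>
      have e : ((j+1 : ℕ) : ℤ) - 1 = j := by push_cast; ring
      rw [e, cz_nat, cz_nat, PowerSeries.coeff_succ_X_mul]

lemma cz_add (f g : PowerSeries ℂ) (j : ℤ) : cz (f + g) j = cz f j + cz g j := by
  unfold cz; split_ifs <;> simp

lemma cz_sub (f g : PowerSeries ℂ) (j : ℤ) : cz (f - g) j = cz f j - cz g j := by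
  unfold cz; split_ifs <;> simp

lemma cz_C (z : ℂ) (f : PowerSeries ℂ) (j : ℤ) : cz (PowerSeries.C z * f) j = z * cz f j := by
  unfold cz; split_ifs <;> simp

/-- geometric series -/
noncomputable def gs (a : ℂ) : PowerSeries ℂ := PowerSeries.mk (fun k => a ^ k)

lemma gs_mul (a : ℂ) : gs a - PowerSeries.C a * (PowerSeries.X * gs a) = 1 := by
  ext k
  cases k with
  | zero => simp [gs]
  | succ k =>
    simp [gs, PowerSeries.coeff_succ_X_mul, PowerSeries.coeff_one]
    ring

open Finset in
lemma main_aux (n : ℕ) (x : Fin n → ℂ) (hx : ∀ j, x j ≠ 0) :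
    ∀ m L : ℕ, m < 2 * L → cz (∏ i, gs (x i + (x i)⁻¹)) m =
      ∑ k ∈ range L, (bc (m+n) k : ℂ) * cz ((∏ i, gs (x i)) * ∏ i, gs (x i)⁻¹) (m - 2 * k) := by
  induction n with
  | zero =>
    intro m L hL
    simp only [univ_eq_empty, prod_empty, mul_one, add_zero]
    have h1 : ∀ j : ℤ, cz 1 j = if j = 0 then 1 else 0 := by
      intro j
      rcases lt_or_ge j 0 with h | h
      · rw [cz_neg _ _ h, if_neg (by omega)]
      · lift j to ℕ using h
        rw [cz_nat, PowerSeries.coeff_one]; simp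
    simp only [h1]
    rcases Nat.eq_zero_or_pos m with rfl | hm
    · rw [sum_eq_single_of_mem 0 (mem_range.2 (by omega))]
      · simp [bc]
      · intro k _ hk
        rw [if_neg (by push_cast; omega), mul_zero]
    · rw [if_neg (by omega), sum_eq_zero]
      intro k _
      split_ifs with h
      · obtain ⟨r, rfl⟩ : ∃ r, k = r + 1 := ⟨k - 1, by omega⟩
        obtain rfl : m = 2 * r + 1 + 1 := by push_cast at h; omega
        rw [bc_succ, Nat.choose_symm_half]; simp
      · simp
  | succ n ih =>
    have H := ih (fun i => x i.succ) (fun i => hx _)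
    refine bc_step n _ _ _ _ (x 0 + (x 0)⁻¹) ?_ (cz_neg _ _ (by norm_num)) ?_
      (fun j hj => cz_neg _ _ hj) H
    · intro j
      rw [← cz_X, ← cz_C, ← cz_sub]
      congr 1
      rw [Fin.prod_univ_succ]
      linear_combination (∏ i : Fin n, gs (x i.succ + (x i.succ)⁻¹)) * gs_mul (x 0 + (x 0)⁻¹)
    · intro j
      rw [show j - 2 = j - 1 - 1 by ring, ← cz_X, ← cz_X, ← cz_X, ← cz_C, ← cz_sub, ← cz_add]
      congr 1
      rw [Fin.prod_univ_succ, Fin.prod_univ_succ (fun i => gs (x i)⁻¹)]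
      have g1 := gs_mul (x 0)
      have g2 := gs_mul (x 0)⁻¹
      have hc : PowerSeries.C (x 0) * PowerSeries.C (x 0)⁻¹ = (1 : PowerSeries ℂ) := by
        rw [← map_mul, mul_inv_cancel₀ (hx 0), map_one]
      rw [map_add]
      set P := ∏ i : Fin n, gs (x i.succ)
      set Q := ∏ i : Fin n, gs (x i.succ)⁻¹
      have g3 := congrArg₂ (· * ·) g1 g2
      simp only [mul_one] at g3
      linear_combination (-P * Q) * g3 +
        P * Q * PowerSeries.X ^ 2 * gs (x 0) * gs (x 0)⁻¹ * hc

/-- `h_m(z) = Σ_{k=0}^{⌊m/2⌋} [(m+n−1)!·(m+n−2k)/(k!·(m+n−k)!)] h_{m−2k}(x,x⁻¹)`. -/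
theorem hsymm_z_eq_sum_hsymm_symplectic (n m : ℕ) (hn : 1 ≤ n)
    (x : Fin n → ℂ) (hx : ∀ j, x j ≠ 0)
    (z : Fin n → ℂ) (hz : ∀ j, z j = x j + (x j)⁻¹) :
    hsymmVal m z
      = ∑ k ∈ Finset.range (m / 2 + 1),
          (((m + n - 1).factorial : ℂ) * ((m + n - 2 * k : ℕ) : ℂ) /
              ((k.factorial : ℂ) * ((m + n - k).factorial : ℂ))) *
            hsymmVal (m - 2 * k) (sympAlph x) := by
  have hs : ∀ j, hsymmVal j (sympAlph x) =
      PowerSeries.coeff j ((∏ i, gs (x i)) * ∏ i, gs (x i)⁻¹) := by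
    intro j
    rw [hs_coeff, Fintype.prod_sum_type]
    rfl
  have hzz : hsymmVal m z = cz (∏ i, gs (x i + (x i)⁻¹)) m := by
    rw [hs_coeff, cz_nat]
    simp only [hz]
    rfl
  rw [hzz, main_aux n x hx m (m / 2 + 1) (by omega)]
  refine Finset.sum_congr rfl fun k hk => ?_
  have hk' : 2 * k ≤ m := by have := Finset.mem_range.1 hk; omega
  rw [bc_formula (m + n) k (by omega) (by omega), hs, ← cz_nat, Nat.cast_sub hk']
  push_cast
  rfl
end

section
/- Let n ≥ 1. For 1 ≤ m ≤ n define the symmetric polynomial EZ_m in the variables z_1, …, z_n by EZ_m := Σ_{k=0}^{⌊m/2⌋} binom(n − m + 2k, k) · e_{m−2k}(z_1, …, z_n). Then the set {EZ_1, …, EZ_n} is a minimal generating subset of the unital ℂ-algebra of symmetric polynomials in z_1, …, z_n: the unital subalgebra generated by EZ_1, …, EZ_n equals the algebra of all symmetric polynomials in n variables, and no proper subset of {EZ_1, …, EZ_n} generates this algebra. -/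
/-- Values of the elementary symmetric polynomials for which `EZ_{m+1}` takes the value `c m`. -/
noncomputable def ezW (n : ℕ) (c : ℕ → ℂ) : ℕ → ℂ
  | 0 => 1
  | (m+1) => c m - ∑ k : Fin ((m+1)/2),
      (((n - (m+1) + 2 * ((k : ℕ)+1)).choose ((k : ℕ)+1) : ℕ) : ℂ) * ezW n c (m + 1 - 2 * ((k : ℕ) + 1))
  decreasing_by omega

theorem ezW_sum (n : ℕ) (c : ℕ → ℂ) (m : ℕ) :
    ∑ k ∈ Finset.range ((m + 1) / 2 + 1),
      (((n - (m+1) + 2 * k).choose k : ℕ) : ℂ) * ezW n c (m + 1 - 2 * k) = c m := by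
  rw [Finset.sum_range_succ']
  have h : ezW n c (m + 1 - 2 * 0) = c m - ∑ k ∈ Finset.range ((m+1)/2),
      (((n - (m+1) + 2 * (k+1)).choose (k+1) : ℕ) : ℂ) * ezW n c (m + 1 - 2 * (k + 1)) := by
    rw [Finset.sum_range]
    exact ezW.eq_2 n c m
  rw [h]
  simp

/-- Evaluation of symmetric polynomials at the prescribed elementary symmetric values. -/
noncomputable def ezHom (n : ℕ) (c : ℕ → ℂ) :
    MvPolynomial.symmetricSubalgebra (Fin n) ℂ →ₐ[ℂ] ℂ :=
  (MvPolynomial.aeval (fun i : Fin n => ezW n c ((i : ℕ) + 1))).comp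
    (MvPolynomial.esymmAlgEquiv (Fin n) ℂ (Fintype.card_fin n)).symm.toAlgHom

/-- Elementary symmetric polynomial as an element of the symmetric subalgebra. -/
noncomputable def ezE (n k : ℕ) : MvPolynomial.symmetricSubalgebra (Fin n) ℂ :=
  ⟨MvPolynomial.esymm (Fin n) ℂ k, MvPolynomial.esymm_isSymmetric (Fin n) ℂ k⟩

theorem ezHom_esymm (n : ℕ) (c : ℕ → ℂ) (k : ℕ) (hk : k ≤ n) :
    ezHom n c (ezE n k) = ezW n c k := by
  cases k with
  | zero =>
    have : ezE n 0 = 1 := by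
      apply Subtype.ext
      simp [ezE]
    rw [this, map_one, ezW]
  | succ k =>
    have := MvPolynomial.esymmAlgEquiv_symm_apply (σ := Fin n) ℂ (Fintype.card_fin n) ⟨k, hk⟩
    simp only [ezHom, ezE, AlgHom.comp_apply]
    erw [this]
    simp

/-- The polynomials `EZ_M = Σ_{k=0}^{⌊M/2⌋} C(n−M+2k, k) e_{M−2k}` for `M = 1, …, n`
form a minimal generating subset of the unital algebra of symmetric polynomials in
`n` variables: they generate the symmetric subalgebra, and no subset of
`{EZ_1, …, EZ_n}` other than the whole set generates it. Here the index `m : Fin n`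
corresponds to `M = m + 1`. -/
theorem ezPolys_minimal_generating (n : ℕ) (hn : 1 ≤ n)
    (EZ : Fin n → MvPolynomial (Fin n) ℂ)
    (hEZ : ∀ m : Fin n, EZ m
      = ∑ k ∈ Finset.range (((m : ℕ) + 1) / 2 + 1),
          MvPolynomial.C (((n - ((m : ℕ) + 1) + 2 * k).choose k : ℕ) : ℂ) *
            MvPolynomial.esymm (Fin n) ℂ (((m : ℕ) + 1) - 2 * k)) :
    Algebra.adjoin ℂ (Set.range EZ) = MvPolynomial.symmetricSubalgebra (Fin n) ℂ ∧
      ∀ S : Set (MvPolynomial (Fin n) ℂ), S ⊆ Set.range EZ →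
        Algebra.adjoin ℂ S = MvPolynomial.symmetricSubalgebra (Fin n) ℂ →
          S = Set.range EZ := by
  have hsymm : ∀ m, EZ m ∈ MvPolynomial.symmetricSubalgebra (Fin n) ℂ := by
    intro m
    rw [hEZ]
    refine Subalgebra.sum_mem _ fun k _ => Subalgebra.mul_mem _ ?_ ?_
    · exact Subalgebra.algebraMap_mem _ _
    · exact MvPolynomial.esymm_isSymmetric _ _ _
  have hval : ∀ (c : ℕ → ℂ) (m : Fin n), ezHom n c ⟨EZ m, hsymm m⟩ = c m := by
    intro c m
    have h : (⟨EZ m, hsymm m⟩ : MvPolynomial.symmetricSubalgebra (Fin n) ℂ)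
        = ∑ k ∈ Finset.range (((m : ℕ) + 1) / 2 + 1),
          (((n - ((m : ℕ) + 1) + 2 * k).choose k : ℕ) : ℂ) • ezE n ((m : ℕ) + 1 - 2 * k) := by
      apply Subtype.ext
      rw [AddSubmonoidClass.coe_finsetSum]
      simp only [hEZ, SetLike.val_smul, ezE, MvPolynomial.smul_eq_C_mul]
    rw [h, map_sum, ← ezW_sum n c m]
    refine Finset.sum_congr rfl fun k _ => ?_
    rw [map_smul, ezHom_esymm _ _ _ (by omega), smul_eq_mul]
  have hgen : ∀ m : ℕ, m ≤ n →
      MvPolynomial.esymm (Fin n) ℂ m ∈ Algebra.adjoin ℂ (Set.range EZ) := by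
    intro m
    induction m using Nat.strong_induction_on with
    | _ m ih =>
    intro hm
    cases m with
    | zero => simpa using Subalgebra.one_mem _
    | succ m =>
      have h := hEZ ⟨m, hm⟩
      rw [Finset.sum_range_succ'] at h
      have h2 := eq_sub_of_add_eq' h.symm
      simp only [mul_zero, Nat.choose_zero_right, Nat.cast_one, MvPolynomial.C_1, one_mul,
        Nat.sub_zero] at h2
      rw [h2]
      refine Subalgebra.sub_mem _ (Algebra.subset_adjoin ⟨_, rfl⟩)
        (Subalgebra.sum_mem _ fun k _ => Subalgebra.mul_mem _ ?_ ?_)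
      · exact Subalgebra.algebraMap_mem _ _
      · exact ih _ (by omega) (by omega)
  refine ⟨le_antisymm ?_ ?_, ?_⟩
  · refine Algebra.adjoin_le ?_
    rintro _ ⟨m, rfl⟩
    exact hsymm m
  · intro p hp
    obtain ⟨q, hq⟩ := (MvPolynomial.esymmAlgHom_fin_bijective ℂ n).2 ⟨p, hp⟩
    have h : p = MvPolynomial.aeval
        (fun i : Fin n => MvPolynomial.esymm (Fin n) ℂ ((i : ℕ) + 1)) q := by
      rw [← MvPolynomial.esymmAlgHom_apply, hq]
    rw [h]
    have h3 : (MvPolynomial.aeval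
        (fun i : Fin n => MvPolynomial.esymm (Fin n) ℂ ((i : ℕ) + 1)) q) ∈
        Algebra.adjoin ℂ (Set.range
          (fun i : Fin n => MvPolynomial.esymm (Fin n) ℂ ((i : ℕ) + 1))) := by
      rw [Algebra.adjoin_range_eq_range_aeval]
      exact ⟨q, rfl⟩
    refine Algebra.adjoin_le ?_ h3
    rintro _ ⟨i, rfl⟩
    exact hgen _ (by omega)
  · intro S hS hadj
    refine Set.Subset.antisymm hS ?_
    rintro _ ⟨j, rfl⟩
    by_contra hj
    let c : ℕ → ℂ := fun i => if i = (j : ℕ) then 1 else 0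
    have hle : Algebra.adjoin ℂ S ≤ (AlgHom.equalizer (ezHom n 0) (ezHom n c)).map
        (MvPolynomial.symmetricSubalgebra (Fin n) ℂ).val := by
      refine Algebra.adjoin_le ?_
      intro p hp
      obtain ⟨i, rfl⟩ := hS hp
      refine ⟨⟨EZ i, hsymm i⟩, ?_, rfl⟩
      change ezHom n 0 ⟨EZ i, hsymm i⟩ = ezHom n c ⟨EZ i, hsymm i⟩
      rw [hval, hval]
      have hij : (i : ℕ) ≠ j := by
        intro h
        rw [Fin.ext h] at hp
        exact hj hp
      simp [c, hij]
    rw [hadj] at hle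
    obtain ⟨x, hx, hxj⟩ := hle (hsymm j)
    have hx2 : x = ⟨EZ j, hsymm j⟩ := Subtype.ext hxj
    subst hx2
    have hx3 : ezHom n 0 ⟨EZ j, hsymm j⟩ = ezHom n c ⟨EZ j, hsymm j⟩ := hx
    rw [hval, hval] at hx3
    simp [c] at hx3
end

section
/- There do not exist univariate polynomials f and g with complex coefficients such that for all complex numbers z_1, z_2, f(z_1)·g(z_2) − f(z_2)·g(z_1) = (z_1 − z_2)·(z_1²·z_2 + z_1·z_2² + z_1 + z_2). -/
/-- There is no bialternant expression with denominator `z₁ − z₂` for the polynomial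
`z₁²z₂ + z₁z₂² + z₁ + z₂` (which is `sz_{(2,1)}(z₁,z₂)`): no univariate polynomials
`f, g` satisfy `f(z₁)g(z₂) − f(z₂)g(z₁) = (z₁ − z₂)(z₁²z₂ + z₁z₂² + z₁ + z₂)`. -/
theorem no_bialternant_for_sz21 :
    ¬ ∃ f g : Polynomial ℂ, ∀ z₁ z₂ : ℂ,
      Polynomial.eval z₁ f * Polynomial.eval z₂ g
          - Polynomial.eval z₂ f * Polynomial.eval z₁ g
        = (z₁ - z₂) * (z₁ ^ 2 * z₂ + z₁ * z₂ ^ 2 + z₁ + z₂) := by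
  rintro ⟨f, g, h⟩
  -- The Plücker relation for the points 0, 1, -1, 2 fails.
  have plucker : ∀ W : ℂ → ℂ → ℂ,
      (∀ a b, W a b = Polynomial.eval a f * Polynomial.eval b g
        - Polynomial.eval b f * Polynomial.eval a g) →
      W 0 1 * W (-1) 2 - W 0 (-1) * W 1 2 + W 0 2 * W 1 (-1) = 0 := by
    intro W hW
    simp only [hW]
    ring
  have key := plucker (fun a b => (a - b) * (a ^ 2 * b + a * b ^ 2 + a + b))
    (fun a b => (h a b).symm)
  norm_num at key
end

section
/- Let n ≥ 1 and m ≥ 1. Let a_0, a_1, …, a_n be complex numbers with a_n ≠ 0, and set a_{−k} := a_k for 1 ≤ k ≤ n and a_k := 0 for |k| > n. Let x_1, …, x_n be nonzero complex numbers such that Σ_{k=−n}^{n} a_k t^k = a_n · t^{−n} · ∏_{j=1}^{n} (t − x_j)(t − x_j^{-1}) for all nonzero complex t. Let T_m(a) be the m × m Toeplitz matrix with (j,k)-entry a_{j−k}, and define H_r := h_r(x_1, …, x_n, x_1^{-1}, …, x_n^{-1}) for r ≥ 0 and H_r := 0 for r < 0. Then det T_m(a) = (−1)^{n·m} · a_n^m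 · det[ H_{m − j + k} ]_{j,k=1}^{n}. -/
lemma mk_geom_mul (y : ℂ) :
    (PowerSeries.mk fun k => y ^ k) * (1 - PowerSeries.C y * PowerSeries.X) = 1 := by
  rw [mul_sub, mul_one, ← mul_assoc, mul_comm _ (PowerSeries.C y)]
  ext k
  rcases k with _ | k
  · simp
  · simp [PowerSeries.coeff_succ_mul_X, PowerSeries.coeff_C_mul, pow_succ', PowerSeries.coeff_one]

lemma mk_hsymmVal {ι : Type*} [Fintype ι] [DecidableEq ι] (y : ι → ℂ) :
    (PowerSeries.mk fun k => hsymmVal k y) = ∏ i, PowerSeries.mk fun k => y i ^ k := by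
  ext d
  rw [PowerSeries.coeff_mk, PowerSeries.coeff_prod, hsymmVal]
  symm
  refine Finset.sum_nbij (fun l => (l : ι → ℕ)) ?_ ?_ ?_ ?_
  · intro l hl
    rw [Finset.mem_finsuppAntidiag] at hl
    rw [Finset.mem_filter, Fintype.mem_piFinset]
    refine ⟨fun i => ?_, hl.1⟩
    rw [Finset.mem_range, Nat.lt_succ_iff, ← hl.1]
    exact Finset.single_le_sum (f := fun i => l i) (fun _ _ => Nat.zero_le _) (Finset.mem_univ i)
  · intro l _ l' _ h
    exact DFunLike.coe_injective h
  · intro f hf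
    rw [Finset.mem_coe, Finset.mem_filter] at hf
    refine ⟨Finsupp.equivFunOnFinite.symm f, ?_, rfl⟩
    rw [Finset.mem_coe, Finset.mem_finsuppAntidiag]
    exact ⟨hf.2, by simp⟩
  · intro l _
    simp

lemma hsymm_inv {ι : Type*} [Fintype ι] [DecidableEq ι] (y : ι → ℂ) :
    (∏ i, (1 - PowerSeries.C (y i) * PowerSeries.X)) *
      (PowerSeries.mk fun k => hsymmVal k y) = 1 := by
  rw [mk_hsymmVal, ← Finset.prod_mul_distrib]
  refine Finset.prod_eq_one fun i _ => ?_
  rw [mul_comm]; exact mk_geom_mul _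

lemma finRotate_pow_val (N k : ℕ) (i : Fin N) :
    (((finRotate N) ^ k) i : ℕ) = (i + k) % N := by
  induction k with
  | zero => simp [Nat.mod_eq_of_lt i.2]
  | succ k ih =>
    have := i.neZero
    rw [pow_succ', Equiv.Perm.mul_apply, finRotate_apply, Fin.val_add, ih]
    rw [Fin.val_one', ← Nat.add_mod]; simp [add_assoc]

lemma sign_rotate_pow (n m : ℕ) (hm : 1 ≤ m) :
    ((Equiv.Perm.sign ((finRotate (n + m)) ^ m) : ℤ) : ℂ) = (-1) ^ (n * m) := by
  obtain ⟨m, rfl⟩ : ∃ k, m = k + 1 := ⟨m - 1, by omega⟩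
  rw [map_pow, sign_finRotate, ← pow_mul]
  have : (n + (m + 1) - 1) * (m + 1) = n * (m + 1) + m * (m + 1) := by
    rw [← add_mul]; congr 1
  rw [this, pow_add]
  have h2 : ((-1 : ℤˣ)) ^ (m * (m + 1)) = 1 := (Nat.even_mul_succ_self m).neg_one_pow
  rw [h2]; simp

/-- Jacobi complementary minor for a corner block. -/
lemma jacobi_corner (n m : ℕ) (hm : 1 ≤ m) (p h : ℤ → ℂ)
    (hp0 : p 0 = 1) (hpn : ∀ k < 0, p k = 0)
    (hinv : ∀ i k : Fin (n + m), ∑ j : Fin (n + m), p ((i : ℕ) - (j : ℕ)) * h ((j : ℕ) - (k : ℕ))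
      = if i = k then 1 else 0) :
    Matrix.det (Matrix.of fun j k : Fin m => p (((j : ℕ) : ℤ) - ((k : ℕ) : ℤ) + n)) =
      (-1) ^ (n * m) * Matrix.det (Matrix.of fun j k : Fin n =>
            h ((m : ℤ) + ((k : ℕ) : ℤ) - ((j : ℕ) : ℤ))) := by
  let L : Matrix (Fin (n + m)) (Fin (n + m)) ℂ := Matrix.of fun i j => p ((i : ℕ) - (j : ℕ))
  let X : Matrix (Fin (n + m)) (Fin (n + m)) ℂ := Matrix.of fun i j =>
    if (j : ℕ) < n then h ((i : ℕ) - (j : ℕ)) else if (i : ℕ) + n = j then 1 else 0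
  have hL : L.det = 1 := by
    rw [Matrix.det_of_lowerTriangular L]
    · simp [L, hp0]
    · intro i j hij
      apply hpn
      have : (i : ℕ) < j := hij
      omega
  have hLX : (L * X).det = Matrix.det (Matrix.of fun j k : Fin m =>
      p (((j : ℕ) : ℤ) - ((k : ℕ) : ℤ) + n)) := by
    rw [← Matrix.det_submatrix_equiv_self finSumFinEquiv (L * X)]
    have : (L * X).submatrix finSumFinEquiv finSumFinEquiv =
        Matrix.fromBlocks 1 (Matrix.of fun (i : Fin n) (j : Fin m) =>
          p (((i : ℕ) : ℤ) - ((j : ℕ) : ℤ))) 0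
          (Matrix.of fun j k : Fin m => p (((j : ℕ) : ℤ) - ((k : ℕ) : ℤ) + n)) := by
      have h2 : ∀ (i : Fin (n + m)) (j : Fin m), (L * X) i (Fin.natAdd n j) =
          p ((i : ℕ) - (j : ℕ)) := by
        intro i j
        have hj : (j : ℕ) < n + m := by omega
        rw [Matrix.mul_apply, Finset.sum_eq_single ⟨j, hj⟩]
        · simp [L, X, add_comm]
        · intro b _ hb
          have : ¬ ((b : ℕ) + n = n + j) := fun h => hb (Fin.ext (by simp; omega))
          simp [X, this]
        · simp
      have h1 : ∀ (i : Fin (n + m)) (j : Fin n), (L * X) i (Fin.castAdd m j) =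
          if i = Fin.castAdd m j then 1 else 0 := by
        intro i j
        rw [Matrix.mul_apply, ← hinv]
        simp [L, X]
      ext (i | i) (j | j)
      · simp [h1, Matrix.one_apply]
      · simp [h2]
      · simp [h1, Fin.ext_iff]; omega
      · simp [h2]; congr 1; ring
    rw [this, Matrix.det_fromBlocks_zero₂₁]; simp
  have hX : (-1) ^ (n * m) * X.det = Matrix.det (Matrix.of fun j k : Fin n =>
            h ((m : ℤ) + ((k : ℕ) : ℤ) - ((j : ℕ) : ℤ))) := by
    rw [← sign_rotate_pow n m hm, ← Matrix.det_permute,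
      ← Matrix.det_submatrix_equiv_self finSumFinEquiv, ← Matrix.det_transpose (Matrix.of _)]
    have : (X.submatrix ((finRotate (n + m)) ^ m) id).submatrix finSumFinEquiv finSumFinEquiv =
        Matrix.fromBlocks (Matrix.of fun j k : Fin n =>
            h ((m : ℤ) + ((k : ℕ) : ℤ) - ((j : ℕ) : ℤ))).transpose 0
          (Matrix.of fun (i : Fin m) (j : Fin n) => h (((i : ℕ) : ℤ) - ((j : ℕ) : ℤ))) 1 := by
      have e1 : ∀ i : Fin n, (((finRotate (n + m)) ^ m) (Fin.castAdd m i) : ℕ) = i + m := by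
        intro i
        rw [finRotate_pow_val, Nat.mod_eq_of_lt] <;> simp
      have e2 : ∀ i : Fin m, (((finRotate (n + m)) ^ m) (Fin.natAdd n i) : ℕ) = i := by
        intro i
        rw [finRotate_pow_val, Fin.val_natAdd, show n + (i : ℕ) + m = i + (n + m) by ring,
          Nat.add_mod_right, Nat.mod_eq_of_lt]
        omega
      ext (i | i) (j | j)
      · simp [X, e1]; congr 1; ring
      · simp [X, e1]; omega
      · simp [X, e2]
      · simp [X, e2, Matrix.one_apply, Fin.ext_iff, add_comm]
    rw [this, Matrix.det_fromBlocks_zero₁₂]; simp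
  rw [← hX, ← hLX, Matrix.det_mul, hL, ← mul_assoc, ← pow_add]
  simp [← two_mul]

lemma toeplitz_inv (N : ℕ) (p h : ℤ → ℂ) (hpn : ∀ k < 0, p k = 0) (hhn : ∀ k < 0, h k = 0)
    (hmul : (PowerSeries.mk fun k : ℕ => p k) * (PowerSeries.mk fun k : ℕ => h k) = 1)
    (i k : Fin N) :
    ∑ j : Fin N, p ((i : ℕ) - (j : ℕ)) * h ((j : ℕ) - (k : ℕ)) = if i = k then 1 else 0 := by
  rcases lt_or_ge (i : ℕ) (k : ℕ) with hik | hik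
  · rw [if_neg (fun h => by subst h; omega)]
    refine Finset.sum_eq_zero fun j _ => ?_
    rcases lt_or_ge (i : ℕ) (j : ℕ) with hij | hij
    · rw [hpn _ (by omega), zero_mul]
    · rw [hhn _ (by omega), mul_zero]
  · have hc := congrArg (PowerSeries.coeff ((i : ℕ) - k)) hmul
    rw [PowerSeries.coeff_mul, PowerSeries.coeff_one] at hc
    have e : (if (i : ℕ) - k = 0 then (1 : ℂ) else 0) = if i = k then 1 else 0 := by
      congr 1; rw [Fin.ext_iff]; exact propext ⟨fun _ => by omega, fun _ => by omega⟩
    rw [← e, ← hc]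
    symm
    refine Finset.sum_of_injOn (fun q => if hq : q.2 + k < N then (⟨q.2 + k, hq⟩ : Fin N) else i)
      ?_ ?_ ?_ ?_
    · intro q hq q' hq' hh
      simp only [Finset.mem_coe, Finset.HasAntidiagonal.mem_antidiagonal] at hq hq'
      have := i.2
      simp only at hh
      rw [dif_pos (by omega), dif_pos (by omega)] at hh
      simp only [Fin.mk.injEq] at hh
      ext <;> omega
    · intro q _; simp
    · intro j _ hj
      rcases lt_or_ge (i : ℕ) (j : ℕ) with hij | hij
      · rw [hpn _ (by omega), zero_mul]
      · rcases lt_or_ge (j : ℕ) (k : ℕ) with hjk | hjk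
        · rw [hhn _ (by omega), mul_zero]
        · exfalso
          apply hj
          refine ⟨((i : ℕ) - j, (j : ℕ) - k), ?_, ?_⟩
          · simp; omega
          · have := j.2
            simp only
            rw [dif_pos (by omega)]
            ext; simp; omega
    · intro q hq
      rw [Finset.HasAntidiagonal.mem_antidiagonal] at hq
      have := i.2
      rw [dif_pos (by omega)]
      simp only [PowerSeries.coeff_mk]
      congr 2 <;> push_cast <;> omega

lemma symbol_series (n : ℕ) (a : ℤ → ℂ) (han : a n ≠ 0)
    (hsupp : ∀ k : ℤ, (n : ℤ) < |k| → a k = 0)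
    (x : Fin n → ℂ) (hx : ∀ j, x j ≠ 0)
    (hfact : ∀ t : ℂ, t ≠ 0 →
      ∑ k ∈ Finset.Icc (-(n : ℤ)) (n : ℤ), a k * t ^ k
        = a n * t ^ (-(n : ℤ)) * ∏ j : Fin n, ((t - x j) * (t - (x j)⁻¹))) :
    (PowerSeries.mk fun k : ℕ => a (k - n) / a n) =
      ∏ i, (1 - PowerSeries.C (sympAlph x i) * PowerSeries.X) := by
  have key : (∑ k ∈ Finset.range (2 * n + 1), Polynomial.C (a (k - n) / a n) * Polynomial.X ^ k) =
      ∏ i, (1 - Polynomial.C (sympAlph x i) * Polynomial.X) := by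
    apply Polynomial.eq_of_infinite_eval_eq
    refine Set.Infinite.mono (s := {0}ᶜ) ?_ (Set.finite_singleton (0 : ℂ)).infinite_compl
    intro t ht
    have ht : t ≠ 0 := ht
    have h1 := hfact t ht
    have h2 : ∑ k ∈ Finset.Icc (-(n : ℤ)) (n : ℤ), a k * t ^ k =
        ∑ k ∈ Finset.range (2 * n + 1), a (k - n) * t ^ ((k : ℤ) - n) := by
      symm
      refine Finset.sum_nbij (fun k => (k : ℤ) - n) ?_ ?_ ?_ ?_
      · intro k hk
        simp at hk ⊢; omega
      · intro k _ k' _ h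
        simp at h; omega
      · intro z hz
        simp at hz
        refine ⟨(z + n).toNat, ?_, ?_⟩
        · simp; omega
        · simp; omega
      · intro k _; rfl
    rw [h2] at h1
    have h3 : ∑ k ∈ Finset.range (2 * n + 1), a (k - n) * t ^ k =
        a n * ∏ j : Fin n, ((t - x j) * (t - (x j)⁻¹)) := by
      have h4 := congrArg (fun z => t ^ (n : ℤ) * z) h1
      simp only [Finset.mul_sum] at h4
      have h5 : t ^ (n : ℤ) * t ^ (-(n : ℤ)) = 1 := by
        rw [← zpow_add₀ ht]; simp
      calc _ = _ := ?_
        _ = _ := h4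
        _ = (t ^ (n : ℤ) * t ^ (-(n : ℤ))) * (a n * ∏ j : Fin n, ((t - x j) * (t - (x j)⁻¹))) := by
          ring
        _ = _ := by rw [h5, one_mul]
      refine Finset.sum_congr rfl fun k _ => ?_
      rw [mul_left_comm, ← zpow_add₀ ht]
      simp
    show Polynomial.eval t _ = Polynomial.eval t _
    rw [Polynomial.eval_finsetSum, Polynomial.eval_prod]
    simp only [Polynomial.eval_mul, Polynomial.eval_C, Polynomial.eval_pow, Polynomial.eval_X,
      Polynomial.eval_sub, Polynomial.eval_one]
    simp only [div_mul_eq_mul_div]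
    rw [← Finset.sum_div, h3, mul_div_cancel_left₀ _ han, Fintype.prod_sum_type,
      ← Finset.prod_mul_distrib]
    refine Finset.prod_congr rfl fun j _ => ?_
    have := hx j
    simp only [sympAlph, Sum.elim_inl, Sum.elim_inr]
    field_simp
    ring
  have key2 := congrArg (Polynomial.coeToPowerSeries.ringHom) key
  rw [map_prod] at key2
  simp only [map_sub, map_one, map_mul, Polynomial.coeToPowerSeries.ringHom_apply,
    Polynomial.coe_C, Polynomial.coe_X] at key2
  rw [← key2]
  ext k
  rw [PowerSeries.coeff_mk, Polynomial.coeff_coe, Polynomial.finsetSum_coeff]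
  simp only [Polynomial.coeff_C_mul_X_pow]
  rw [Finset.sum_ite_eq]
  split_ifs with hk
  · rfl
  · rw [hsupp, zero_div]
    simp at hk
    rw [abs_of_nonneg] <;> omega

/-- Determinant of the banded symmetric Toeplitz matrix generated by the palindromic
Laurent polynomial `a(t) = Σ_{k=−n}^{n} a_k t^k = a_n t^{−n} ∏_j (t − x_j)(t − x_j⁻¹)`:
`det T_m(a) = (−1)^{nm} a_n^m det[H_{m−j+k}]_{j,k=1}^n`, where `H_r = h_r(x, x⁻¹)` for
`r ≥ 0` and `H_r = 0` for `r < 0`. With 0-based indices the Jacobi–Trudi entry is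
`H (m + k₀ − j₀)`. -/
theorem det_symmetric_banded_toeplitz (n m : ℕ) (hn : 1 ≤ n) (hm : 1 ≤ m)
    (a : ℤ → ℂ) (han : a n ≠ 0)
    (hsymm : ∀ k : ℤ, a (-k) = a k)
    (hsupp : ∀ k : ℤ, (n : ℤ) < |k| → a k = 0)
    (x : Fin n → ℂ) (hx : ∀ j, x j ≠ 0)
    (hfact : ∀ t : ℂ, t ≠ 0 →
      ∑ k ∈ Finset.Icc (-(n : ℤ)) (n : ℤ), a k * t ^ k
        = a n * t ^ (-(n : ℤ)) * ∏ j : Fin n, ((t - x j) * (t - (x j)⁻¹)))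
    (H : ℤ → ℂ)
    (hH : ∀ r : ℤ, 0 ≤ r → H r = hsymmVal r.toNat (sympAlph x))
    (hHneg : ∀ r : ℤ, r < 0 → H r = 0) :
    Matrix.det (Matrix.of fun j k : Fin m => a (((j : ℕ) : ℤ) - ((k : ℕ) : ℤ)))
      = (-1 : ℂ) ^ (n * m) * a n ^ m *
          Matrix.det (Matrix.of fun j k : Fin n =>
            H ((m : ℤ) + ((k : ℕ) : ℤ) - ((j : ℕ) : ℤ))) := by
  have hinv := toeplitz_inv (n + m) (fun k => a (k - n) / a n) H
    (fun k hk => by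
      change a (k - n) / a n = 0
      rw [hsupp _ (by rw [abs_of_neg] <;> omega), zero_div]) hHneg (by
      rw [symbol_series n a han hsupp x hx hfact]
      have : (PowerSeries.mk fun k : ℕ => H k) =
          PowerSeries.mk fun k => hsymmVal k (sympAlph x) := by
        ext k; simp [hH]
      rw [this]; exact hsymm_inv _)
  have hj := jacobi_corner n m hm (fun k => a (k - n) / a n) H
    (by simp [hsymm, han])
    (fun k hk => by
      change a (k - n) / a n = 0
      rw [hsupp _ (by rw [abs_of_neg] <;> omega), zero_div]) hinv
  have hs : (Matrix.of fun j k : Fin m => a (((j : ℕ) : ℤ) - ((k : ℕ) : ℤ))) =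
      a n • (Matrix.of fun j k : Fin m =>
        (fun k : ℤ => a (k - n) / a n) (((j : ℕ) : ℤ) - ((k : ℕ) : ℤ) + n)) := by
    ext i j
    simp [mul_div_cancel₀ _ han]
  rw [hs, Matrix.det_smul, hj, Fintype.card_fin]
  ring
end
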